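/- Let n = 2^{a_1} + 2^{a_2} + ⋯ + 2^{a_r} + ε ≥ 2, where a_1 > ⋯ > a_r > 0 and ε ∈ {0,1}. Then G_0(n) = G_0(2^{a_r} + ε) · ∏_{j=1}^{r−1} (2^{a_j} − 2). Moreover, 𝒢_0(n) = O(n) holds exactly for n ∈ {2, 3, 5}, and 𝒢_0(n) = {(n), (1^n)} holds exactly for n ∈ {2, 3, 4}. -/

import Mathlib

namespace OddSym

open scoped Classical

/-- Remove one box from a row of size `p` (as multisets of parts). -/
def removeBox (lam : Multiset ℕ) (p : ℕ) : Multiset ℕ :=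
  if p ≤ 1 then lam.erase p else (p - 1) ::ₘ lam.erase p

lemma removeBox_sum_lt {lam : Multiset ℕ} {p : ℕ} (hp : p ∈ lam) (h0 : 0 < p) :
    (removeBox lam p).sum < lam.sum := by
  have h : p + (lam.erase p).sum = lam.sum := by
    conv_rhs => rw [← Multiset.cons_erase hp]
    simp [Multiset.sum_cons]
  unfold removeBox
  split
  · omega
  · simp only [Multiset.sum_cons]
    omega

/-- The number of standard Young tableaux of shape `lam`
(equivalently, the degree of the irreducible character of the symmetric
group labelled by `lam`), defined via the branching rule. -/
def degSYT (lam : Multiset ℕ) : ℕ :=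
  if _h : lam = 0 then 1
  else ∑ p ∈ (lam.toFinset.filter (fun p => 0 < p)).attach, degSYT (removeBox lam p.1)
termination_by lam.sum
decreasing_by
  have hp := p.2
  simp only [Finset.mem_filter, Multiset.mem_toFinset] at hp
  exact removeBox_sum_lt hp.1 hp.2

/-- `lam` is an odd partition: all parts positive and the number of standard
Young tableaux of shape `lam` (= the character degree) is odd. -/
def OddP (lam : Multiset ℕ) : Prop :=
  (∀ x ∈ lam, 0 < x) ∧ Odd (degSYT lam)

/-- The parts of `lam` sorted in weakly decreasing order. -/
def descList (lam : Multiset ℕ) : List ℕ :=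
  (lam.sort (· ≤ ·)).reverse

/-- The beta-set (set of beta-numbers) of `lam` with `m` beads:
`{ lam_i + (m - i) : 1 ≤ i ≤ m }` where `lam` is padded with zero parts. -/
def betaSet (lam : Multiset ℕ) (m : ℕ) : Finset ℕ :=
  (Finset.range m).image (fun i => (descList lam).getD i 0 + (m - 1 - i))

/-- `mu` is obtained from `lam` by removing an `e`-hook: in some beta-set of
`lam` a beta-number `x` is replaced by `x - e` (which is not a beta-number). -/
def IsHookRemoval (e : ℕ) (lam mu : Multiset ℕ) : Prop :=
  (∀ x ∈ lam, 0 < x) ∧ (∀ x ∈ mu, 0 < x) ∧ 0 < e ∧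
  ∃ m x, Multiset.card lam ≤ m ∧ Multiset.card mu ≤ m ∧
    x ∈ betaSet lam m ∧ e ≤ x ∧ x - e ∉ betaSet lam m ∧
    betaSet mu m = insert (x - e) ((betaSet lam m).erase x)

/-- The map `f_k` : for an odd partition `lam` with `2^k ≤ |lam|`, the unique
odd partition obtained from `lam` by removing a `2^k`-hook (junk value `0` if
no such partition exists). -/
noncomputable def fkOp (k : ℕ) (lam : Multiset ℕ) : Multiset ℕ :=
  if h : ∃ mu, IsHookRemoval (2 ^ k) lam mu ∧ OddP mu then h.choose else 0

/-- The partition encoded by a finite beta-set: each bead contributes a part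
equal to the number of gaps below it. -/
def partOfBeta (S : Finset ℕ) : Multiset ℕ :=
  (S.val.map (fun b => b - (S.filter (fun a => a < b)).card)).filter (fun p => 0 < p)

/-- The 2-quotient `(lam_0, lam_1)` of `lam`, computed from a beta-set with an
even number of beads via the two runners of the 2-abacus. -/
def quot2 (lam : Multiset ℕ) : Multiset ℕ × Multiset ℕ :=
  (partOfBeta (((betaSet lam (2 * Multiset.card lam)).filter (fun b => b % 2 = 0)).image
      (fun b => b / 2)),
   partOfBeta (((betaSet lam (2 * Multiset.card lam)).filter (fun b => b % 2 = 1)).image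
      (fun b => b / 2)))

/-- The `e`-core of `lam`: push all beads of an `e`-abacus configuration for
`lam` up as far as possible. -/
def coreP (e : ℕ) (lam : Multiset ℕ) : Multiset ℕ :=
  partOfBeta ((Finset.range (e * (Multiset.card lam + e))).filter
    (fun x => x / e <
      ((betaSet lam (Multiset.card lam + e)).filter (fun b => b % e = x % e)).card))

/-- Row `k` of the 2-quotient tower of `lam`: row 0 is `[lam]`, and row `k+1`
replaces each entry of row `k` by its 2-quotient pair. -/
def towerRow : ℕ → Multiset ℕ → List (Multiset ℕ)
  | 0, lam => [lam]
  | (k + 1), lam => (towerRow k lam).flatMap (fun mu => [(quot2 mu).1, (quot2 mu).2])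

/-- `R_k^j(lam)`: the component of row `k` of the 2-quotient tower of `lam`
from which a `2^(j-k)`-hook is removed in the passage from `lam` to `f_j(lam)`;
it is characterized by: row `k` for `f_j(lam)` is obtained from row `k` for
`lam` by replacing this component by its image under `f_(j-k)`. -/
noncomputable def Rcomp (k j : ℕ) (lam : Multiset ℕ) : Multiset ℕ :=
  if h : ∃ s, s < 2 ^ k ∧
      towerRow k (fkOp j lam) =
        (towerRow k lam).set s (fkOp (j - k) ((towerRow k lam).getD s 0))
  then (towerRow k lam).getD h.choose 0 else 0


/-- `G_k(n)`, the number of odd partitions `lam` of `n` with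
`f_k(f_k(lam)) = f_(k+1)(lam)`. -/
noncomputable def Gnum (k n : ℕ) : ℕ :=
  {lam : Multiset ℕ | OddP lam ∧ lam.sum = n ∧
    fkOp k (fkOp k lam) = fkOp (k + 1) lam}.ncard

lemma partOfBeta_pos {S : Finset ℕ} {x : ℕ} (hx : x ∈ partOfBeta S) : 0 < x :=
  (Multiset.mem_filter.1 hx).2

lemma card_partOfBeta_le (S : Finset ℕ) : Multiset.card (partOfBeta S) ≤ S.card := by
  unfold partOfBeta
  exact (Multiset.card_le_card (Multiset.filter_le _ _)).trans (by simp)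

lemma partOfBeta_insert_max {S : Finset ℕ} {b : ℕ} (hb : ∀ a ∈ S, a < b) :
    partOfBeta (insert b S) =
      (if 0 < b - S.card then {b - S.card} else 0) + partOfBeta S := by
  have hbS : b ∉ S := fun h => lt_irrefl _ (hb b h)
  unfold partOfBeta
  rw [Finset.insert_val_of_notMem hbS, Multiset.map_cons, Multiset.filter_cons]
  have h1 : (insert b S).filter (fun a => a < b) = S := by
    ext a
    simp only [Finset.mem_filter, Finset.mem_insert]
    constructor
    · rintro ⟨rfl | h, h'⟩
      · omega
      · exact h
    · intro h
      exact ⟨Or.inr h, hb a h⟩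
  rw [h1]
  congr 2
  apply Multiset.map_congr rfl
  intro x hx
  have hx' : x ∈ S := hx
  have : (insert b S).filter (fun a => a < x) = S.filter (fun a => a < x) := by
    rw [Finset.filter_insert, if_neg]
    have := hb x hx'
    omega
  rw [this]

lemma card_le_of_forall_lt {S : Finset ℕ} {b : ℕ} (hb : ∀ a ∈ S, a < b) : S.card ≤ b := by
  have : S ⊆ Finset.range b := fun a ha => Finset.mem_range.2 (hb a ha)
  simpa using Finset.card_le_card this

lemma sum_eq_partOfBeta_sum (S : Finset ℕ) :
    S.sum id = (partOfBeta S).sum + (Finset.range S.card).sum id := by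
  induction S using Finset.induction_on_max with
  | empty => simp [partOfBeta]
  | insert b S hb ih =>
    have hbS : b ∉ S := fun h => lt_irrefl _ (hb b h)
    rw [Finset.sum_insert hbS, ih, partOfBeta_insert_max hb, Finset.card_insert_of_notMem hbS,
      Finset.sum_range_succ, Multiset.sum_add]
    have := card_le_of_forall_lt hb
    split_ifs with h
    · simp
      omega
    · simp
      omega

lemma descList_zero : descList 0 = [] := by simp [descList]

lemma descList_perm (lam : Multiset ℕ) : (descList lam : Multiset ℕ) = lam := by
  simp [descList]

lemma length_descList (lam : Multiset ℕ) : (descList lam).length = Multiset.card lam := by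
  simp [descList]

lemma descList_sorted (lam : Multiset ℕ) : (descList lam).Pairwise (· ≥ ·) := by
  unfold descList
  rw [List.pairwise_reverse]
  exact Multiset.pairwise_sort lam (· ≤ ·)

lemma eq_descList {l : List ℕ} {lam : Multiset ℕ} (h : (l : Multiset ℕ) = lam)
    (hl : l.Pairwise (· ≥ ·)) : descList lam = l := by
  apply List.Perm.eq_of_pairwise (le := (· ≥ ·)) _ (descList_sorted lam) hl
  · rw [← Multiset.coe_eq_coe, descList_perm, h]
  · intro a b _ _ h1 h2
    exact le_antisymm h2 h1

lemma descList_cons {lam : Multiset ℕ} {p : ℕ} (hp : ∀ x ∈ lam, x ≤ p) :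
    descList (p ::ₘ lam) = p :: descList lam := by
  apply eq_descList
  · rw [← Multiset.cons_coe, descList_perm]
  · rw [List.pairwise_cons]
    refine ⟨fun a ha => hp a ?_, descList_sorted lam⟩
    rw [← descList_perm lam]
    exact ha

lemma betaSet_zero (m : ℕ) : betaSet 0 m = Finset.range m := by
  unfold betaSet
  rw [descList_zero]
  ext x
  simp only [Finset.mem_image, Finset.mem_range, List.getD_nil, zero_add]
  constructor
  · rintro ⟨i, hi, rfl⟩
    omega
  · intro h
    exact ⟨m - 1 - x, by omega, by omega⟩

lemma betaSet_cons {lam : Multiset ℕ} {p : ℕ} (hp : ∀ x ∈ lam, x ≤ p) (m : ℕ) :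
    betaSet (p ::ₘ lam) (m + 1) = insert (p + m) (betaSet lam m) := by
  unfold betaSet
  rw [descList_cons hp]
  ext x
  simp only [Finset.mem_image, Finset.mem_range, Finset.mem_insert]
  constructor
  · rintro ⟨i, hi, rfl⟩
    cases i with
    | zero => left; simp
    | succ j =>
      right
      refine ⟨j, by omega, ?_⟩
      simp only [List.getD_cons_succ]
      omega
  · rintro (rfl | ⟨j, hj, rfl⟩)
    · exact ⟨0, by omega, by simp⟩
    · refine ⟨j + 1, by omega, ?_⟩
      simp only [List.getD_cons_succ]
      omega

lemma betaSet_succ {lam : Multiset ℕ} {m : ℕ} (h : Multiset.card lam ≤ m) :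
    betaSet lam (m + 1) = insert 0 ((betaSet lam m).image Nat.succ) := by
  unfold betaSet
  rw [← length_descList] at h
  ext x
  simp only [Finset.mem_image, Finset.mem_range, Finset.mem_insert]
  constructor
  · rintro ⟨i, hi, rfl⟩
    rcases Nat.lt_succ_iff_lt_or_eq.1 hi with h' | rfl
    · right
      exact ⟨_, ⟨i, h', rfl⟩, by omega⟩
    · left
      rw [List.getD_eq_default _ _ h]
      omega
  · rintro (rfl | ⟨_, ⟨i, hi, rfl⟩, rfl⟩)
    · refine ⟨m, by omega, ?_⟩
      rw [List.getD_eq_default _ _ h]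
      omega
    · exact ⟨i, by omega, by omega⟩

/-- Induction on a partition by removing its largest part. -/
lemma induction_max {P : Multiset ℕ → Prop} (h0 : P 0)
    (h1 : ∀ p lam, (∀ x ∈ lam, x ≤ p) → P lam → P (p ::ₘ lam)) (lam : Multiset ℕ) : P lam := by
  have key : ∀ l : List ℕ, l.Pairwise (· ≥ ·) → P (l : Multiset ℕ) := by
    intro l
    induction l with
    | nil => intro; exact h0
    | cons p l ih =>
      intro h
      rw [List.pairwise_cons] at h
      exact h1 p l (fun x hx => h.1 x hx) (ih h.2)
  rw [← descList_perm lam]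
  exact key _ (descList_sorted lam)

lemma lt_of_mem_betaSet {lam : Multiset ℕ} {p m x : ℕ} (hp : ∀ y ∈ lam, y ≤ p)
    (hx : x ∈ betaSet lam m) : x < p + m := by
  unfold betaSet at hx
  simp only [Finset.mem_image, Finset.mem_range] at hx
  obtain ⟨i, hi, rfl⟩ := hx
  have : (descList lam).getD i 0 ≤ p := by
    by_cases h : i < (descList lam).length
    · rw [List.getD_eq_getElem _ _ h]
      apply hp
      have : (descList lam)[i] ∈ (descList lam : Multiset ℕ) := List.getElem_mem h
      rwa [descList_perm] at this
    · rw [List.getD_eq_default _ _ (by omega)]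
      omega
  omega

lemma partOfBeta_range (m : ℕ) : partOfBeta (Finset.range m) = 0 := by
  unfold partOfBeta
  rw [Multiset.filter_eq_nil]
  intro a ha
  simp only [Multiset.mem_map] at ha
  obtain ⟨b, hb, rfl⟩ := ha
  have hb' : b < m := Finset.mem_range.1 hb
  have : (Finset.range m).filter (fun a => a < b) = Finset.range b := by
    ext; simp; omega
  rw [this]
  simp

lemma card_betaSet {lam : Multiset ℕ} : ∀ {m : ℕ}, Multiset.card lam ≤ m →
    (betaSet lam m).card = m := by
  induction lam using induction_max with
  | h0 => intro m _; simp [betaSet_zero]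
  | h1 p lam hp ih =>
    intro m hm
    rw [Multiset.card_cons] at hm
    obtain ⟨m, rfl⟩ : ∃ k, m = k + 1 := ⟨m - 1, by omega⟩
    rw [betaSet_cons hp, Finset.card_insert_of_notMem, ih (by omega)]
    intro h
    exact lt_irrefl _ (lt_of_mem_betaSet hp h)

lemma partOfBeta_betaSet {lam : Multiset ℕ} : (∀ x ∈ lam, 0 < x) →
    ∀ {m : ℕ}, Multiset.card lam ≤ m → partOfBeta (betaSet lam m) = lam := by
  induction lam using induction_max with
  | h0 => intro _ m _; rw [betaSet_zero, partOfBeta_range]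
  | h1 p lam hp ih =>
    intro h0 m hm
    rw [Multiset.card_cons] at hm
    obtain ⟨m, rfl⟩ : ∃ k, m = k + 1 := ⟨m - 1, by omega⟩
    have hm' : Multiset.card lam ≤ m := by omega
    rw [betaSet_cons hp, partOfBeta_insert_max fun a ha => lt_of_mem_betaSet hp ha,
      ih (fun x hx => h0 x (Multiset.mem_cons_of_mem hx)) hm', card_betaSet hm',
      Nat.add_sub_cancel, if_pos (h0 p (Multiset.mem_cons_self _ _)), Multiset.singleton_add]

lemma betaSet_partOfBeta (S : Finset ℕ) : betaSet (partOfBeta S) S.card = S := by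
  induction S using Finset.induction_on_max with
  | empty => simp [betaSet]
  | insert b S hb ih =>
    have hbS : b ∉ S := fun h => lt_irrefl _ (hb b h)
    have hc := card_le_of_forall_lt hb
    rw [partOfBeta_insert_max hb, Finset.card_insert_of_notMem hbS]
    split_ifs with h
    · rw [Multiset.singleton_add, betaSet_cons, ih, Nat.sub_add_cancel hc]
      intro x hx
      obtain ⟨y, hy, rfl⟩ := Multiset.mem_map.1 (Multiset.mem_filter.1 hx).1
      have hy' : y ∈ S := hy
      have h1 : S.card ≤ (S.filter (fun a => a < y)).card + (b - y) := by
        have : S ⊆ S.filter (fun a => a < y) ∪ Finset.Ico y b := by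
          intro z hz
          have := hb z hz
          simp only [Finset.mem_union, Finset.mem_filter, Finset.mem_Ico]
          by_cases h : z < y
          · exact Or.inl ⟨hz, h⟩
          · exact Or.inr ⟨by omega, by omega⟩
        refine (Finset.card_le_card this).trans ((Finset.card_union_le _ _).trans ?_)
        simp
      have := hb y hy'
      omega
    · have hS : S = Finset.range b := by
        apply Finset.eq_of_subset_of_card_le
        · exact fun a ha => Finset.mem_range.2 (hb a ha)
        · simp; omega
      subst hS
      rw [partOfBeta_range, add_zero, betaSet_zero, Finset.card_range, Finset.range_add_one]

/-- Move the bead `x` of `S` down by `e`. -/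
def mv (e : ℕ) (S : Finset ℕ) (x : ℕ) : Finset ℕ := insert (x - e) (S.erase x)

/-- The beads of `S` that can be moved down by `e`. -/
def Mov (e : ℕ) (S : Finset ℕ) : Finset ℕ := S.filter (fun x => e ≤ x ∧ x - e ∉ S)

/-- The size of the partition encoded by `S`. -/
def wt (S : Finset ℕ) : ℕ := (partOfBeta S).sum

/-- The parity of the degree of the partition encoded by `S`. -/
noncomputable def dS (S : Finset ℕ) : ZMod 2 := (degSYT (partOfBeta S) : ZMod 2)

lemma mem_Mov {e x : ℕ} {S : Finset ℕ} : x ∈ Mov e S ↔ x ∈ S ∧ e ≤ x ∧ x - e ∉ S := by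
  simp [Mov]

lemma mem_mv {e x y : ℕ} {S : Finset ℕ} : y ∈ mv e S x ↔ y = x - e ∨ (y ≠ x ∧ y ∈ S) := by
  simp [mv]

lemma card_mv {e x : ℕ} {S : Finset ℕ} (hx : x ∈ Mov e S) : (mv e S x).card = S.card := by
  rw [mem_Mov] at hx
  have hpos : 0 < S.card := Finset.card_pos.2 ⟨x, hx.1⟩
  rw [mv, Finset.card_insert_of_notMem (fun h => hx.2.2 (Finset.mem_of_mem_erase h)),
    Finset.card_erase_of_mem hx.1]
  omega

lemma sum_mv {e x : ℕ} {S : Finset ℕ} (hx : x ∈ Mov e S) :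
    (mv e S x).sum id + e = S.sum id := by
  rw [mem_Mov] at hx
  rw [mv, Finset.sum_insert (fun h => hx.2.2 (Finset.mem_of_mem_erase h)),
    ← Finset.add_sum_erase S id hx.1]
  simp only [id]
  omega

lemma wt_mv {e x : ℕ} {S : Finset ℕ} (hx : x ∈ Mov e S) : wt (mv e S x) + e = wt S := by
  have h1 := sum_mv hx
  rw [sum_eq_partOfBeta_sum S, sum_eq_partOfBeta_sum (mv e S x), card_mv hx] at h1
  unfold wt
  omega

lemma wt_range (m : ℕ) : wt (Finset.range m) = 0 := by simp [wt, partOfBeta_range]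

lemma eq_range_of_wt_eq_zero {S : Finset ℕ} (h : wt S = 0) : S = Finset.range S.card := by
  have h0 : partOfBeta S = 0 := by
    rw [Multiset.eq_zero_iff_forall_notMem]
    intro x hx
    have h1 := partOfBeta_pos hx
    have h2 := Multiset.le_sum_of_mem hx
    unfold wt at h
    omega
  have := betaSet_partOfBeta S
  rw [h0, betaSet_zero] at this
  exact this.symm

lemma mv_injOn {e : ℕ} {S : Finset ℕ} : Set.InjOn (mv e S) (Mov e S) := by
  intro x hx y hy h
  rw [Finset.mem_coe, mem_Mov] at hx hy
  by_contra hne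
  have h1 : x ∈ mv e S y := mem_mv.2 (Or.inr ⟨hne, hx.1⟩)
  rw [← h, mem_mv] at h1
  rcases h1 with h1 | h1
  · have : e = 0 := by omega
    subst this
    exact hx.2.2 (by simpa using hx.1)
  · exact h1.1 rfl

lemma degSYT_zero : degSYT 0 = 1 := by
  rw [degSYT]; simp

lemma degSYT_ne_zero {lam : Multiset ℕ} (h : lam ≠ 0) :
    degSYT lam = ∑ p ∈ lam.toFinset.filter (fun p => 0 < p), degSYT (removeBox lam p) := by
  rw [degSYT, dif_neg h]
  exact Finset.sum_attach (lam.toFinset.filter (fun p => 0 < p)) (fun p => degSYT (removeBox lam p))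

/-- The part contributed by the bead `b`. -/
def part (S : Finset ℕ) (b : ℕ) : ℕ := b - (S.filter (fun a => a < b)).card

lemma partOfBeta_mv {S : Finset ℕ} {x : ℕ} (hx : x ∈ Mov 1 S) :
    0 < part S x ∧ part S x ∈ partOfBeta S ∧
      partOfBeta (mv 1 S x) = removeBox (partOfBeta S) (part S x) := by
  have hx' := hx
  rw [mem_Mov] at hx
  obtain ⟨hxS, h1, hn⟩ := hx
  have hfx : (S.filter (fun a => a < x)) ⊆ Finset.range (x - 1) := by
    intro a ha
    simp only [Finset.mem_filter, Finset.mem_range] at ha ⊢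
    have : a ≠ x - 1 := by rintro rfl; exact hn ha.1
    omega
  have hfc : (S.filter (fun a => a < x)).card ≤ x - 1 := by
    simpa using Finset.card_le_card hfx
  have hpos : 0 < part S x := by unfold part; omega
  have hval : S.val = x ::ₘ (S.erase x).val := by
    rw [Finset.erase_val, Multiset.cons_erase hxS]
  have hval' : (mv 1 S x).val = (x - 1) ::ₘ (S.erase x).val := by
    unfold mv
    rw [Finset.insert_val_of_notMem (fun h => hn (Finset.mem_of_mem_erase h))]
  have hrest : ((S.erase x).val.map (part (mv 1 S x))) = ((S.erase x).val.map (part S)) := by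
    apply Multiset.map_congr rfl
    intro a ha
    have ha' : a ∈ S.erase x := ha
    rw [Finset.mem_erase] at ha'
    have hane : a ≠ x - 1 := by rintro rfl; exact hn ha'.2
    unfold part
    congr 1
    by_cases hax : x < a
    · have e1 : (mv 1 S x).filter (fun b => b < a) = mv 1 (S.filter (fun b => b < a)) x := by
        ext b
        simp only [Finset.mem_filter, mem_mv]
        constructor
        · rintro ⟨h | h, h'⟩
          · exact Or.inl h
          · exact Or.inr ⟨h.1, h.2, h'⟩
        · rintro (h | h)
          · exact ⟨Or.inl h, by omega⟩
          · exact ⟨Or.inr ⟨h.1, h.2.1⟩, h.2.2⟩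
      rw [e1, card_mv]
      rw [mem_Mov]
      simp only [Finset.mem_filter]
      exact ⟨⟨hxS, hax⟩, h1, fun h => hn h.1⟩
    · congr 1
      ext b
      simp only [Finset.mem_filter, mem_mv]
      constructor
      · rintro ⟨h | h, h'⟩
        · omega
        · exact ⟨h.2, h'⟩
      · rintro ⟨h, h'⟩
        exact ⟨Or.inr ⟨by omega, h⟩, h'⟩
  have hpx : part (mv 1 S x) (x - 1) = part S x - 1 := by
    unfold part
    have : (mv 1 S x).filter (fun a => a < x - 1) = S.filter (fun a => a < x) := by
      ext b
      have := fun h => @hfx b h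
      simp only [Finset.mem_filter, mem_mv, Finset.mem_range] at this ⊢
      constructor
      · rintro ⟨h | h, h'⟩
        · omega
        · exact ⟨h.2, by omega⟩
      · rintro h
        exact ⟨Or.inr ⟨by omega, h.1⟩, this h⟩
    rw [this]
    omega
  set R := ((S.erase x).val.map (part S)).filter (fun p => 0 < p) with hR
  have hP : partOfBeta S = part S x ::ₘ R := by
    have : partOfBeta S = (S.val.map (part S)).filter (fun p => 0 < p) := rfl
    rw [this, hval, Multiset.map_cons, Multiset.filter_cons_of_pos _ hpos]
  have hP' : partOfBeta (mv 1 S x) =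
      ((part S x - 1) ::ₘ (S.erase x).val.map (part S)).filter (fun p => 0 < p) := by
    have : partOfBeta (mv 1 S x) =
      ((mv 1 S x).val.map (part (mv 1 S x))).filter (fun p => 0 < p) := rfl
    rw [this, hval', Multiset.map_cons, hpx, hrest]
  refine ⟨hpos, ?_, ?_⟩
  · rw [hP]; exact Multiset.mem_cons_self _ _
  · rw [hP', hP]
    unfold removeBox
    rw [Multiset.erase_cons_head]
    split_ifs with h
    · rw [Multiset.filter_cons_of_neg]
      omega
    · rw [Multiset.filter_cons_of_pos]
      omega

lemma part_lt_part {S : Finset ℕ} {x y : ℕ} (hx : x ∈ S) (hy : y ∈ Mov 1 S) (h : x < y) :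
    part S x < part S y := by
  rw [mem_Mov] at hy
  have h1 : S.filter (fun a => a < y) ⊆
      S.filter (fun a => a < x) ∪ (Finset.Ico x (y - 1)) := by
    intro z hz
    simp only [Finset.mem_filter, Finset.mem_union, Finset.mem_Ico] at hz ⊢
    have : z ≠ y - 1 := by rintro rfl; exact hy.2.2 hz.1
    by_cases h : z < x
    · exact Or.inl ⟨hz.1, h⟩
    · right; omega
  have h2 := (Finset.card_le_card h1).trans (Finset.card_union_le _ _)
  have h3 : (S.filter (fun a => a < x)).card ≤ x :=
    card_le_of_forall_lt fun a ha => (Finset.mem_filter.1 ha).2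
  have : x ≠ y - 1 := by rintro rfl; exact hy.2.2 hx
  rw [Nat.card_Ico] at h2
  unfold part
  omega

lemma degSYT_partOfBeta {S : Finset ℕ} (h : 0 < wt S) :
    degSYT (partOfBeta S) = ∑ x ∈ Mov 1 S, degSYT (partOfBeta (mv 1 S x)) := by
  have h0 : partOfBeta S ≠ 0 := by
    intro h0
    unfold wt at h
    rw [h0] at h
    simp at h
  rw [degSYT_ne_zero h0]
  symm
  apply Finset.sum_bij (fun x _ => part S x)
  · intro x hx
    obtain ⟨h1, h2, -⟩ := partOfBeta_mv hx
    simp [h1, h2]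
  · intro x hx y hy hxy
    by_contra hne
    rcases Nat.lt_or_gt_of_ne hne with h | h
    · have := part_lt_part (mem_Mov.1 hx).1 hy h
      omega
    · have := part_lt_part (mem_Mov.1 hy).1 hx h
      omega
  · intro p hp
    simp only [Finset.mem_filter, Multiset.mem_toFinset] at hp
    obtain ⟨hp, hp0⟩ := hp
    have hne : (S.filter (fun b => part S b = p)).Nonempty := by
      obtain ⟨b, hb, hbp⟩ := Multiset.mem_map.1 (Multiset.mem_filter.1 hp).1
      exact ⟨b, Finset.mem_filter.2 ⟨hb, hbp⟩⟩
    set x := (S.filter (fun b => part S b = p)).min' hne with hx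
    have hxm := Finset.min'_mem _ hne
    rw [← hx, Finset.mem_filter] at hxm
    have hx1 : 1 ≤ x := by
      by_contra h
      have hx0 : x = 0 := by omega
      have := hxm.2
      rw [hx0] at this
      simp [part] at this
      omega
    refine ⟨x, mem_Mov.2 ⟨hxm.1, hx1, ?_⟩, hxm.2⟩
    intro hmem
    have h2 : part S (x - 1) = p := by
      rw [← hxm.2]
      have : S.filter (fun a => a < x) = insert (x - 1) (S.filter (fun a => a < x - 1)) := by
        ext b
        simp only [Finset.mem_filter, Finset.mem_insert]
        constructor
        · rintro ⟨h, h'⟩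
          by_cases hb : b = x - 1
          · exact Or.inl hb
          · exact Or.inr ⟨h, by omega⟩
        · rintro (rfl | h)
          · exact ⟨hmem, by omega⟩
          · exact ⟨h.1, by omega⟩
      unfold part
      rw [this, Finset.card_insert_of_notMem (by simp)]
      omega
    have hm2 : x - 1 ∈ S.filter (fun b => part S b = p) := Finset.mem_filter.2 ⟨hmem, h2⟩
    have := Finset.min'_le _ _ hm2
    rw [← hx] at this
    omega
  · intro x hx
    rw [(partOfBeta_mv hx).2.2]

lemma dS_range (m : ℕ) : dS (Finset.range m) = 1 := by
  simp [dS, partOfBeta_range, degSYT_zero]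

lemma dS_rec {S : Finset ℕ} (h : 0 < wt S) : dS S = ∑ x ∈ Mov 1 S, dS (mv 1 S x) := by
  unfold dS
  rw [degSYT_partOfBeta h]
  push_cast
  rfl

lemma odd_iff_dS {lam : Multiset ℕ} (h0 : ∀ x ∈ lam, 0 < x) {m : ℕ}
    (hm : Multiset.card lam ≤ m) : OddP lam ↔ dS (betaSet lam m) = 1 := by
  unfold OddP dS
  rw [partOfBeta_betaSet h0 hm, ZMod.natCast_eq_one_iff_odd]
  exact ⟨fun h => h.2, fun h => ⟨h0, h⟩⟩

lemma sum_sum_ne_eq_zero (A : Finset ℕ) (F : ℕ → ℕ → ZMod 2) (h : ∀ x y, F x y = F y x) :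
    ∑ x ∈ A, ∑ y ∈ A.erase x, F x y = 0 := by
  rw [Finset.sum_sigma']
  refine Finset.sum_involution (fun p _ => ⟨p.2, p.1⟩) ?_ ?_ ?_ ?_
  · rintro ⟨x, y⟩ _
    show F x y + F y x = 0
    rw [h x y]
    exact CharTwo.add_self_eq_zero _
  · rintro ⟨x, y⟩ hp _ heq
    simp only [Finset.mem_sigma, Finset.mem_erase] at hp
    simp only [Sigma.mk.injEq] at heq
    exact hp.2.1 heq.1
  · rintro ⟨x, y⟩ hp
    simp only [Finset.mem_sigma, Finset.mem_erase] at hp ⊢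
    exact ⟨hp.2.2, fun h => hp.2.1 h.symm, hp.1⟩
  · rintro ⟨x, y⟩ _
    rfl

lemma Mov_mv {e : ℕ} (he : 0 < e) {S : Finset ℕ} {x : ℕ} (hx : x ∈ Mov e S) :
    Mov e (mv e S x) = ((Mov e S).erase x) ∪
      ((if x ∈ Mov (2 * e) S then {x - e} else ∅) ∪ (if x + e ∈ S then {x + e} else ∅)) := by
  rw [mem_Mov] at hx
  ext y
  by_cases h1 : x ∈ Mov (2 * e) S <;> by_cases h2 : x + e ∈ S <;>
    simp only [h1, h2, if_true, if_false, Finset.mem_union, Finset.mem_erase, Finset.mem_singleton,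
      Finset.notMem_empty, or_false, false_or] <;>
    rw [mem_Mov] at h1 <;> simp only [mem_Mov, mem_mv] <;> grind

lemma sum_sum_mv (F : Finset ℕ → ZMod 2) {e : ℕ} (he : 0 < e) (S : Finset ℕ) :
    ∑ x ∈ Mov e S, ∑ y ∈ Mov e (mv e S x), F (mv e (mv e S x) y) =
      ∑ x ∈ Mov (2 * e) S, F (mv (2 * e) S x) := by
  have h1 : ∀ x ∈ Mov e S, ∑ y ∈ Mov e (mv e S x), F (mv e (mv e S x) y) =
      ∑ y ∈ (Mov e S).erase x, F (mv e (mv e S x) y) +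
      ((if x ∈ Mov (2 * e) S then F (mv (2 * e) S x) else 0) +
        (if x + e ∈ S then F (mv (2 * e) S (x + e)) else 0)) := by
    intro x hx
    have hx' := mem_Mov.1 hx
    rw [Mov_mv he hx, Finset.sum_union, Finset.sum_union]
    · congr 2
      · split_ifs with h
        · rw [Finset.sum_singleton]
          congr 1
          rw [mem_Mov] at h
          ext z
          simp only [mem_mv]
          grind
        · rfl
      · split_ifs with h
        · rw [Finset.sum_singleton]
          congr 1
          ext z
          simp only [mem_mv]
          grind
        · rfl
    · split_ifs <;> simp
      omega
    · rw [Finset.disjoint_left]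
      intro y hy
      rw [Finset.mem_erase, mem_Mov] at hy
      split_ifs <;> simp <;> grind
  rw [Finset.sum_congr rfl h1, Finset.sum_add_distrib, Finset.sum_add_distrib]
  have h2 : ∑ x ∈ Mov e S, ∑ y ∈ (Mov e S).erase x, F (mv e (mv e S x) y) = 0 := by
    have : ∀ x ∈ Mov e S, ∑ y ∈ (Mov e S).erase x, F (mv e (mv e S x) y) =
        ∑ y ∈ (Mov e S).erase x,
          F (insert (x - e) (insert (y - e) ((S.erase x).erase y))) := by
      intro x hx
      apply Finset.sum_congr rfl
      intro y hy
      rw [mem_Mov] at hx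
      rw [Finset.mem_erase, mem_Mov] at hy
      congr 1
      ext z
      simp only [mem_mv, Finset.mem_insert, Finset.mem_erase]
      grind
    rw [Finset.sum_congr rfl this]
    apply sum_sum_ne_eq_zero
    intro x y
    rw [Finset.insert_comm, Finset.erase_right_comm]
  have h3 : ∑ x ∈ Mov e S, (if x ∈ Mov (2 * e) S then F (mv (2 * e) S x) else 0) =
      ∑ x ∈ (Mov (2 * e) S).filter (fun x => x - e ∉ S), F (mv (2 * e) S x) := by
    rw [← Finset.sum_filter]
    apply Finset.sum_congr _ (fun _ _ => rfl)
    ext x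
    simp only [Finset.mem_filter, mem_Mov]
    grind
  have h4 : ∑ x ∈ Mov e S, (if x + e ∈ S then F (mv (2 * e) S (x + e)) else 0) =
      ∑ x ∈ (Mov (2 * e) S).filter (fun x => ¬ x - e ∉ S), F (mv (2 * e) S x) := by
    rw [← Finset.sum_filter]
    apply Finset.sum_bij (fun x _ => x + e)
    · intro x hx
      simp only [Finset.mem_filter, mem_Mov] at hx ⊢
      have : x + e - 2 * e = x - e := by omega
      rw [this, Nat.add_sub_cancel]
      grind
    · intro x _ y _ h
      omega
    · intro y hy
      simp only [Finset.mem_filter, mem_Mov, exists_prop] at hy ⊢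
      refine ⟨y - e, ?_, by omega⟩
      have : y - e - e = y - 2 * e := by omega
      rw [this, Nat.sub_add_cancel (by omega)]
      grind
    · intro x _
      rfl
  rw [h2, h3, h4, zero_add, Finset.sum_filter_add_sum_filter_not]

lemma dS_sum (k : ℕ) : ∀ {S : Finset ℕ}, 2 ^ k ≤ wt S →
    dS S = ∑ x ∈ Mov (2 ^ k) S, dS (mv (2 ^ k) S x) := by
  induction k with
  | zero => intro S h; exact dS_rec (by simp at h; omega)
  | succ k ih =>
    intro S h
    rw [pow_succ, mul_comm] at h ⊢
    rw [← sum_sum_mv dS (by positivity), ih (by omega)]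
    apply Finset.sum_congr rfl
    intro x hx
    apply ih
    have := wt_mv hx
    omega

/-- `T` encodes a `q`-core. -/
def IsCore (q : ℕ) (T : Finset ℕ) : Prop := ∀ x ∈ T, q ≤ x → x - q ∈ T

/-- Move the bead `t` of `T` up by `q`. -/
def up (q : ℕ) (T : Finset ℕ) (t : ℕ) : Finset ℕ := insert (t + q) (T.erase t)

/-- The beads of `T` that can be moved up by `q`. -/
def Ends (q : ℕ) (T : Finset ℕ) : Finset ℕ := T.filter (fun t => t + q ∉ T)

/-- `U` encodes an odd partition obtained from `S` by removing a `2 ^ k`-hook. -/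
def Ch (k : ℕ) (S U : Finset ℕ) : Prop :=
  ∃ x ∈ Mov (2 ^ k) S, U = mv (2 ^ k) S x ∧ dS U = 1

/-- The end of `mv e T x` corresponding to the end `t` of `T`. -/
def shiftEnd (q e x t : ℕ) : ℕ := if t = x then x - e else if t + q + e = x then x - q else t

lemma mem_up {q t y : ℕ} {T : Finset ℕ} : y ∈ up q T t ↔ y = t + q ∨ (y ≠ t ∧ y ∈ T) := by
  simp [up]

lemma mem_Ends {q t : ℕ} {T : Finset ℕ} : t ∈ Ends q T ↔ t ∈ T ∧ t + q ∉ T := by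
  simp [Ends]

lemma isCore_of_wt_lt {q : ℕ} {T : Finset ℕ} (h : wt T < q) : IsCore q T := by
  intro x hx hqx
  by_contra hn
  have := wt_mv (mem_Mov.2 ⟨hx, hqx, hn⟩)
  omega

lemma mem_Mov_up {q : ℕ} {T : Finset ℕ} (hq : 0 < q) {t : ℕ} :
    t + q ∈ Mov q (up q T t) := by
  simp only [mem_Mov, mem_up]
  refine ⟨Or.inl trivial, by omega, ?_⟩
  omega

lemma mv_up {q : ℕ} {T : Finset ℕ} {t : ℕ} (ht : t ∈ Ends q T) :
    mv q (up q T t) (t + q) = T := by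
  rw [mem_Ends] at ht
  ext y
  simp only [mem_mv, mem_up]
  grind

lemma Mov_up {q : ℕ} (hq : 0 < q) {T : Finset ℕ} (hT : IsCore q T) {t : ℕ} :
    Mov q (up q T t) = {t + q} := by
  ext y
  rw [Finset.mem_singleton]
  constructor
  · intro hy
    have := hT y
    simp only [mem_Mov, mem_up] at hy
    grind
  · rintro rfl
    exact mem_Mov_up hq

lemma wt_up {q : ℕ} (hq : 0 < q) {T : Finset ℕ} {t : ℕ} (ht : t ∈ Ends q T) :
    wt (up q T t) = wt T + q := by
  rw [← wt_mv (mem_Mov_up (T := T) (t := t) hq), mv_up ht]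

lemma card_up {q : ℕ} (hq : 0 < q) {T : Finset ℕ} {t : ℕ} (ht : t ∈ Ends q T) :
    (up q T t).card = T.card := by
  rw [← card_mv (mem_Mov_up (T := T) (t := t) hq), mv_up ht]

lemma dS_up {a : ℕ} {T : Finset ℕ} (hT : IsCore (2 ^ a) T) {t : ℕ}
    (ht : t ∈ Ends (2 ^ a) T) : dS (up (2 ^ a) T t) = dS T := by
  have hq : 0 < 2 ^ a := by positivity
  rw [dS_sum a (by rw [wt_up hq ht]; omega), Mov_up hq hT, Finset.sum_singleton, mv_up ht]

lemma up_inj {q : ℕ} (hq : 0 < q) {T T' : Finset ℕ} (hT : IsCore q T) (hT' : IsCore q T')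
    {t t' : ℕ} (ht : t ∈ Ends q T) (ht' : t' ∈ Ends q T') (h : up q T t = up q T' t') :
    T = T' ∧ t = t' := by
  have h1 := Mov_up hq hT (t := t)
  rw [h, Mov_up hq hT', Finset.singleton_inj] at h1
  have h2 : t = t' := by omega
  refine ⟨?_, h2⟩
  subst h2
  rw [← mv_up ht, h, mv_up ht']

lemma mv_mem_Ends {q : ℕ} (hq : 0 < q) {S : Finset ℕ} {x : ℕ} (hx : x ∈ Mov q S) :
    x - q ∈ Ends q (mv q S x) ∧ S = up q (mv q S x) (x - q) := by
  rw [mem_Mov] at hx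
  constructor
  · simp only [mem_Ends, mem_mv]
    grind
  · ext y
    simp only [mem_up, mem_mv]
    grind

lemma exists_Ch {k : ℕ} {S : Finset ℕ} (hS : dS S = 1) (h : 2 ^ k ≤ wt S) :
    ∃ S', Ch k S S' := by
  rw [dS_sum k h] at hS
  have : ∑ x ∈ Mov (2 ^ k) S, dS (mv (2 ^ k) S x) ≠ 0 := by rw [hS]; decide
  obtain ⟨x, hx, hne⟩ := Finset.exists_ne_zero_of_sum_ne_zero this
  refine ⟨_, x, hx, rfl, ?_⟩
  generalize dS (mv (2 ^ k) S x) = z at hne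
  revert z
  decide

lemma exists_up {a : ℕ} {S : Finset ℕ} (hS : dS S = 1) (h1 : 2 ^ a ≤ wt S)
    (h2 : wt S < 2 * 2 ^ a) :
    ∃ T t, IsCore (2 ^ a) T ∧ dS T = 1 ∧ t ∈ Ends (2 ^ a) T ∧ S = up (2 ^ a) T t ∧
      wt T + 2 ^ a = wt S ∧ T.card = S.card := by
  obtain ⟨T, x, hx, rfl, hT⟩ := exists_Ch hS h1
  obtain ⟨h3, h4⟩ := mv_mem_Ends (by positivity) hx
  have h5 := wt_mv hx
  exact ⟨_, _, isCore_of_wt_lt (by omega), hT, h3, h4, h5, card_mv hx⟩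

lemma Mov_up_struct {q e : ℕ} (he : 0 < e) (hq : e < q) {T U : Finset ℕ}
    (hT : IsCore q T) (hU : IsCore q U) {t w z : ℕ} (ht : t ∈ Ends q T) (hw : w ∈ Ends q U)
    (hz : z ∈ Mov e (up q T t)) (h : mv e (up q T t) z = up q U w) :
    ∃ x ∈ Mov e T, U = mv e T x ∧ w = shiftEnd q e x t := by
  have hmem : ∀ y, y ∈ up q U w ↔ y = z - e ∨ (y ≠ z ∧ y ∈ up q T t) := by
    intro y
    rw [← h, mem_mv]
  have hUm : ∀ y, y ∈ U ↔ y = w ∨ (y ≠ w + q ∧ y ∈ up q U w) := by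
    intro y
    rw [mem_Ends] at hw
    rw [mem_up]
    grind
  have hwq : w + q ∈ up q U w := mem_up.2 (Or.inl rfl)
  have hww : w ∉ up q U w := by
    rw [mem_up]
    omega
  simp only [hmem, mem_up] at hUm hwq hww
  rw [mem_Ends] at ht
  simp only [mem_Mov, mem_up] at hz
  clear h hmem
  by_cases hwt : w = t
  · subst hwt
    refine ⟨z, ?_, ?_, ?_⟩
    · rw [mem_Mov]
      grind
    · ext y
      rw [hUm, mem_mv]
      grind
    · unfold shiftEnd
      rw [if_neg, if_neg] <;> grind
  · by_cases h1 : w + q = z - e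
    · have h2 : z = t + q := by
        by_contra hne
        have := hU (t + q)
        rw [hUm, hUm] at this
        grind
      subst h2
      refine ⟨t, ?_, ?_, ?_⟩
      · rw [mem_Mov]
        grind
      · ext y
        rw [hUm, mem_mv]
        grind
      · unfold shiftEnd
        rw [if_pos rfl]
        omega
    · have h2 := hT (w + q)
      rw [Nat.add_sub_cancel] at h2
      have h3 : w = z := by grind
      subst h3
      have h4 : t + e = w := by
        have := hU (t + q)
        rw [hUm, hUm] at this
        grind
      refine ⟨w + q, ?_, ?_, ?_⟩
      · rw [mem_Mov]
        grind
      · ext y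
        rw [hUm, mem_mv]
        grind
      · unfold shiftEnd
        rw [if_neg, if_pos] <;> omega

lemma Ch.dS_eq {k : ℕ} {S S' : Finset ℕ} (h : Ch k S S') : dS S' = 1 := by
  obtain ⟨x, hx, rfl, h⟩ := h
  exact h

lemma Ch.wt_eq {k : ℕ} {S S' : Finset ℕ} (h : Ch k S S') : wt S' + 2 ^ k = wt S := by
  obtain ⟨x, hx, rfl, h⟩ := h
  exact wt_mv hx

lemma Ch.card_eq {k : ℕ} {S S' : Finset ℕ} (h : Ch k S S') : S'.card = S.card := by
  obtain ⟨x, hx, rfl, h⟩ := h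
  exact card_mv hx

lemma Ch_up_struct {a k : ℕ} (hk : k < a) {T S' : Finset ℕ}
    (hT : wt T < 2 ^ a) (hkT : 2 ^ k ≤ wt T) {t : ℕ}
    (ht : t ∈ Ends (2 ^ a) T) (h : Ch k (up (2 ^ a) T t) S') :
    ∃ x ∈ Mov (2 ^ k) T, dS (mv (2 ^ k) T x) = 1 ∧
      shiftEnd (2 ^ a) (2 ^ k) x t ∈ Ends (2 ^ a) (mv (2 ^ k) T x) ∧
      S' = up (2 ^ a) (mv (2 ^ k) T x) (shiftEnd (2 ^ a) (2 ^ k) x t) := by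
  have hq : 0 < 2 ^ a := by positivity
  have hk0 : 0 < 2 ^ k := by positivity
  have hwt := h.wt_eq
  rw [wt_up hq ht] at hwt
  obtain ⟨U, w, hU, hdU, hw, hS', -, -⟩ := exists_up (a := a) h.dS_eq (by omega) (by omega)
  obtain ⟨z, hz, rfl, hd⟩ := h
  obtain ⟨x, hx, rfl, rfl⟩ := Mov_up_struct (by positivity)
    (Nat.pow_lt_pow_right (by norm_num) hk) (isCore_of_wt_lt hT) hU ht hw hz hS'
  exact ⟨x, hx, hdU, hw, hS'⟩

lemma exists_pow_le {n : ℕ} (h : 0 < n) : ∃ a, 2 ^ a ≤ n ∧ n < 2 * 2 ^ a := by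
  refine ⟨Nat.log 2 n, Nat.pow_log_le_self 2 (by omega), ?_⟩
  have := Nat.lt_pow_succ_log_self (b := 2) (by norm_num) n
  rw [pow_succ] at this
  omega

/-- An odd partition has a unique odd partition obtained by removing a `2 ^ k`-hook. -/
lemma Ch_unique (n : ℕ) : ∀ {k : ℕ} {S S₁ S₂ : Finset ℕ}, wt S = n → dS S = 1 →
    Ch k S S₁ → Ch k S S₂ → S₁ = S₂ := by
  induction n using Nat.strong_induction_on with
  | _ n ih =>
    intro k S S₁ S₂ hn hS h1 h2
    have hkn : 2 ^ k ≤ n := by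
      have := h1.wt_eq
      omega
    have hk0 : 0 < 2 ^ k := by positivity
    obtain ⟨a, ha1, ha2⟩ := exists_pow_le (show 0 < n by omega)
    have hq : 0 < 2 ^ a := by positivity
    obtain ⟨T, t, hT, hdT, ht, rfl, hwT, -⟩ := exists_up hS (hn ▸ ha1) (hn ▸ ha2)
    rw [hn] at hwT
    have hka : k ≤ a := by
      by_contra hlt
      have : 2 ^ (a + 1) ≤ 2 ^ k := Nat.pow_le_pow_right (by norm_num) (by omega)
      rw [pow_succ] at this
      omega
    rcases Nat.lt_or_eq_of_le hka with hka | rfl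
    · by_cases hkT : 2 ^ k ≤ wt T
      · obtain ⟨x, hx, hdx, -, rfl⟩ := Ch_up_struct hka (by omega) hkT ht h1
        obtain ⟨y, hy, hdy, -, rfl⟩ := Ch_up_struct hka (by omega) hkT ht h2
        have := ih (wt T) (by omega) rfl hdT ⟨x, hx, rfl, hdx⟩ ⟨y, hy, rfl, hdy⟩
        rw [mv_injOn hx hy this]
      · have hTc : IsCore (2 ^ k) T := isCore_of_wt_lt (by omega)
        have hsub : Mov (2 ^ k) (up (2 ^ a) T t) ⊆ {t + 2 ^ k, t + 2 ^ a} := by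
          intro y hy
          have := hTc y
          simp only [mem_Mov, mem_up] at hy
          simp only [Finset.mem_insert, Finset.mem_singleton]
          grind
        obtain ⟨x, hx, rfl, hdx⟩ := h1
        obtain ⟨y, hy, rfl, hdy⟩ := h2
        by_contra hne
        have hxy : x ≠ y := by
          rintro rfl
          exact hne rfl
        have hM : Mov (2 ^ k) (up (2 ^ a) T t) = {x, y} := by
          symm
          apply Finset.eq_of_subset_of_card_le
          · intro z hz
            simp only [Finset.mem_insert, Finset.mem_singleton] at hz
            rcases hz with rfl | rfl <;> assumption
          · rw [Finset.card_pair hxy]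
            exact (Finset.card_le_card hsub).trans Finset.card_le_two
        rw [dS_sum k (by omega), hM, Finset.sum_pair hxy, hdx, hdy] at hS
        revert hS
        decide
    · obtain ⟨x, hx, rfl, hdx⟩ := h1
      obtain ⟨y, hy, rfl, hdy⟩ := h2
      rw [Mov_up hq hT, Finset.mem_singleton] at hx hy
      rw [hx, hy]

/-- Removing two boxes one after the other agrees with removing a `2`-hook. -/
def Good (S : Finset ℕ) : Prop := ∃ S₁ S₂, Ch 0 S S₁ ∧ Ch 0 S₁ S₂ ∧ Ch 1 S S₂

/-- The beta-sets with `M` beads of the odd partitions of `n`. -/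
noncomputable def OS (M n : ℕ) : Finset (Finset ℕ) :=
  ((Finset.range (M + n)).powerset).filter (fun S => S.card = M ∧ wt S = n ∧ dS S = 1)

/-- The good members of `OS M n`. -/
noncomputable def GS (M n : ℕ) : Finset (Finset ℕ) := (OS M n).filter Good

lemma card_le_sum {lam : Multiset ℕ} (h : ∀ x ∈ lam, 0 < x) : Multiset.card lam ≤ lam.sum := by
  simpa using Multiset.card_nsmul_le_sum (s := lam) (a := 1) h

lemma lt_of_mem {S : Finset ℕ} {x : ℕ} (hx : x ∈ S) : x < S.card + wt S := by
  rw [← betaSet_partOfBeta S] at hx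
  have := lt_of_mem_betaSet (p := wt S) (fun y hy => Multiset.le_sum_of_mem hy) hx
  omega

lemma mem_of_lt {S : Finset ℕ} {j : ℕ} (h : j + wt S < S.card) : j ∈ S := by
  rw [← betaSet_partOfBeta S]
  unfold betaSet
  rw [Finset.mem_image]
  refine ⟨S.card - 1 - j, Finset.mem_range.2 (by omega), ?_⟩
  rw [List.getD_eq_default]
  · omega
  · rw [length_descList]
    have h1 := card_le_sum (lam := partOfBeta S) (fun x hx => partOfBeta_pos hx)
    unfold wt at h
    omega

lemma mem_OS {M n : ℕ} {S : Finset ℕ} : S ∈ OS M n ↔ S.card = M ∧ wt S = n ∧ dS S = 1 := by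
  unfold OS
  rw [Finset.mem_filter, Finset.mem_powerset]
  constructor
  · exact fun h => h.2
  · intro h
    refine ⟨fun x hx => ?_, h⟩
    rw [Finset.mem_range, ← h.1, ← h.2.1]
    exact lt_of_mem hx

lemma mem_GS {M n : ℕ} {S : Finset ℕ} : S ∈ GS M n ↔ S ∈ OS M n ∧ Good S := by
  simp [GS]

lemma card_Ends {q : ℕ} {T : Finset ℕ} (hT : IsCore q T) (h : q + wt T ≤ T.card) :
    (Ends q T).card = q := by
  have h1 : (T.filter (fun t => t + q ∈ T)).card = (T.filter (fun t => q ≤ t)).card := by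
    apply Finset.card_bij (fun t _ => t + q)
    · intro t ht
      rw [Finset.mem_filter] at ht ⊢
      exact ⟨ht.2, by omega⟩
    · intro t _ t' _ h
      omega
    · intro t ht
      rw [Finset.mem_filter] at ht
      refine ⟨t - q, Finset.mem_filter.2 ⟨hT t ht.1 ht.2, ?_⟩, by omega⟩
      rw [Nat.sub_add_cancel ht.2]
      exact ht.1
  have h2 : (T.filter (fun t => ¬ q ≤ t)) = Finset.range q := by
    ext t
    rw [Finset.mem_filter, Finset.mem_range]
    constructor
    · intro h
      omega
    · intro ht
      exact ⟨mem_of_lt (by omega), by omega⟩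
  have h3 := Finset.card_filter_add_card_filter_not (s := T) (fun t => q ≤ t)
  have h4 := Finset.card_filter_add_card_filter_not (s := T) (fun t => t + q ∈ T)
  rw [h2, Finset.card_range] at h3
  unfold Ends
  omega

lemma card_biUnion_up {q c : ℕ} (hq : 0 < q) (A : Finset (Finset ℕ)) (E : Finset ℕ → Finset ℕ)
    (hA : ∀ T ∈ A, IsCore q T) (hE : ∀ T ∈ A, E T ⊆ Ends q T) (hc : ∀ T ∈ A, (E T).card = c) :
    (A.biUnion (fun T => (E T).image (up q T))).card = A.card * c := by
  rw [Finset.card_biUnion]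
  · rw [Finset.sum_congr rfl (g := fun _ => c), Finset.sum_const, smul_eq_mul]
    intro T hT
    rw [Finset.card_image_of_injOn, hc T hT]
    intro t ht t' ht' h
    exact (up_inj hq (hA T hT) (hA T hT) (hE T hT ht) (hE T hT ht') h).2
  · intro T hT T' hT' hne
    rw [Function.onFun, Finset.disjoint_left]
    intro S hS hS'
    rw [Finset.mem_image] at hS hS'
    obtain ⟨t, ht, rfl⟩ := hS
    obtain ⟨t', ht', h⟩ := hS'
    exact hne (up_inj hq (hA T hT) (hA T' hT') (hE T hT ht) (hE T' hT' ht') h.symm).1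

lemma card_OS {a M n : ℕ} (hn : n < 2 ^ a) (hM : n + 2 ^ a ≤ M) :
    (OS M (n + 2 ^ a)).card = (OS M n).card * 2 ^ a := by
  have hq : 0 < 2 ^ a := by positivity
  have hcore : ∀ T ∈ OS M n, IsCore (2 ^ a) T := fun T hT =>
    isCore_of_wt_lt (by rw [(mem_OS.1 hT).2.1]; exact hn)
  rw [← card_biUnion_up hq (OS M n) (Ends (2 ^ a)) hcore (fun T _ => Finset.Subset.refl _)]
  · congr 1
    ext S
    simp only [Finset.mem_biUnion, Finset.mem_image]
    constructor
    · intro hS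
      rw [mem_OS] at hS
      obtain ⟨T, t, hT, hdT, ht, rfl, hwT, hc⟩ := exists_up (a := a) hS.2.2 (by omega) (by omega)
      exact ⟨T, mem_OS.2 ⟨by omega, by omega, hdT⟩, t, ht, rfl⟩
    · rintro ⟨T, hT, t, ht, rfl⟩
      have hTc := hcore T hT
      rw [mem_OS] at hT
      rw [mem_OS, card_up hq ht, wt_up hq ht, dS_up hTc ht]
      exact ⟨hT.1, by rw [hT.2.1], hT.2.2⟩
  · intro T hT
    apply card_Ends (hcore T hT)
    rw [mem_OS] at hT
    omega

lemma Ch_up_iff {a k : ℕ} (hk : k < a) {T S' : Finset ℕ} (hd : dS T = 1)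
    (hT : wt T < 2 ^ a) {t x : ℕ}
    (ht : t ∈ Ends (2 ^ a) T) (hx : x ∈ Mov (2 ^ k) T) (hdx : dS (mv (2 ^ k) T x) = 1) :
    Ch k (up (2 ^ a) T t) S' ↔ shiftEnd (2 ^ a) (2 ^ k) x t ∈ Ends (2 ^ a) (mv (2 ^ k) T x) ∧
      S' = up (2 ^ a) (mv (2 ^ k) T x) (shiftEnd (2 ^ a) (2 ^ k) x t) := by
  have hkT : 2 ^ k ≤ wt T := by
    have := wt_mv hx
    omega
  have key : ∀ S', Ch k (up (2 ^ a) T t) S' →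
      shiftEnd (2 ^ a) (2 ^ k) x t ∈ Ends (2 ^ a) (mv (2 ^ k) T x) ∧
      S' = up (2 ^ a) (mv (2 ^ k) T x) (shiftEnd (2 ^ a) (2 ^ k) x t) := by
    intro S' h
    obtain ⟨y, hy, hdy, h1, h2⟩ := Ch_up_struct hk hT hkT ht h
    have h3 := Ch_unique _ rfl hd ⟨x, hx, rfl, hdx⟩ ⟨y, hy, rfl, hdy⟩
    have h4 := mv_injOn hx hy h3
    subst h4
    exact ⟨h1, h2⟩
  refine ⟨key S', fun h => ?_⟩
  have hq : 0 < 2 ^ a := by positivity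
  obtain ⟨S'', h''⟩ := exists_Ch (k := k) (S := up (2 ^ a) T t)
    (by rw [dS_up (isCore_of_wt_lt hT) ht, hd]) (by rw [wt_up hq ht]; omega)
  rw [h.2, ← (key S'' h'').2]
  exact h''

/-- The ends of `T` for which the upward move of a good set stays good. -/
noncomputable def goodEnds (q : ℕ) (T : Finset ℕ) : Finset ℕ :=
  (Ends q T).filter (fun t => Good (up q T t))

lemma card_filter_shiftEnd {q x x' y : ℕ} (hq : 2 < q) {T : Finset ℕ}
    (hx : x ∈ Mov 1 T) (hx' : x' ∈ Mov 1 (mv 1 T x)) (hy : y ∈ Mov 2 T)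
    (h : mv 1 (mv 1 T x) x' = mv 2 T y) (h1 : IsCore q (mv 1 T x)) (h2 : IsCore q (mv 2 T y))
    (hlow : ∀ j < q, j ∈ T) (hc : (Ends q T).card = q) :
    ((Ends q T).filter (fun t => shiftEnd q 1 x' (shiftEnd q 1 x t) = shiftEnd q 2 y t)).card =
      q - 2 := by
  have hm : ∀ z, (z = x' - 1 ∨ z ≠ x' ∧ (z = x - 1 ∨ z ≠ x ∧ z ∈ T)) ↔
      (z = y - 2 ∨ z ≠ y ∧ z ∈ T) := by
    intro z
    have : z ∈ mv 1 (mv 1 T x) x' ↔ z ∈ mv 2 T y := by rw [h]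
    simpa only [mem_mv] using this
  have hxq : q ≤ x - 1 := by
    by_contra hlt
    exact (mem_Mov.1 hx).2.2 (hlow _ (by omega))
  have hyq : q ≤ y - 2 := by
    by_contra hlt
    exact (mem_Mov.1 hy).2.2 (hlow _ (by omega))
  simp only [mem_Mov, mem_mv] at hx hx' hy
  unfold IsCore at h1 h2
  simp only [mem_mv] at h1 h2
  have hcases : (x' = x - 1 ∧ y = x) ∨ (x' = x + 1 ∧ y = x + 1) := by
    have e1 := hm y
    have e2 := hm (y - 2)
    have e3 := hm (x - 1)
    have e4 := hm x
    grind
  have key : ∀ u v, u ≠ v → u ∈ Ends q T → v ∈ Ends q T →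
      (∀ t ∈ Ends q T, shiftEnd q 1 x' (shiftEnd q 1 x t) = shiftEnd q 2 y t ↔
        ¬ (t = u ∨ t = v)) →
      ((Ends q T).filter
        (fun t => shiftEnd q 1 x' (shiftEnd q 1 x t) = shiftEnd q 2 y t)).card = q - 2 := by
    intro u v huv hu hv hall
    have : (Ends q T).filter
        (fun t => shiftEnd q 1 x' (shiftEnd q 1 x t) = shiftEnd q 2 y t) =
        ((Ends q T).erase u).erase v := by
      ext t
      rw [Finset.mem_filter, Finset.mem_erase, Finset.mem_erase]
      constructor
      · rintro ⟨ht, h⟩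
        rw [hall t ht] at h
        tauto
      · rintro ⟨h3, h4, h5⟩
        refine ⟨h5, ?_⟩
        rw [hall t h5]
        tauto
    rw [this, Finset.card_erase_of_mem (Finset.mem_erase.2 ⟨huv.symm, hv⟩),
      Finset.card_erase_of_mem hu, hc]
    omega
  rcases hcases with ⟨rfl, rfl⟩ | ⟨rfl, rfl⟩
  · obtain ⟨c, rfl⟩ : ∃ c, y = c + 2 + q := ⟨y - 2 - q, by omega⟩
    have r1 : c + 2 + q - 1 = c + 1 + q := by omega
    have r2 : c + 2 + q - 2 = c + q := by omega
    have r3 : c + 1 + q - 1 = c + q := by omega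
    simp only [r1, r2, r3] at hx hx' hy h1 h2
    have b1 : c + 1 ∈ T := by
      have := h1 (c + 1 + q) (Or.inl rfl) (by omega)
      rw [Nat.add_sub_cancel] at this
      rcases this with h | h
      · omega
      · exact h.2
    have b2 : c ∈ T := by
      have := h2 (c + q) (Or.inl rfl) (by omega)
      rw [Nat.add_sub_cancel] at this
      rcases this with h | h
      · omega
      · exact h.2
    have b3 : c + 1 + q ∉ T := hx.2.2
    have b4 : c + q ∉ T := hy.2.2
    have b5 : c + 2 + q ∈ T := hy.1
    apply key (c + 1) c (by omega) (mem_Ends.2 ⟨b1, b3⟩) (mem_Ends.2 ⟨b2, b4⟩)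
    intro t ht
    rw [mem_Ends] at ht
    have c1 : t ≠ c + 1 + q := fun h => b3 (h ▸ ht.1)
    have c2 : t ≠ c + q := fun h => b4 (h ▸ ht.1)
    have c3 : t ≠ c + 2 := fun h => ht.2 (h ▸ b5)
    clear key h1 h2 hm hlow hx hx' hy h
    unfold shiftEnd
    split_ifs <;> omega
  · obtain ⟨c, rfl⟩ : ∃ c, x = c + 1 + q := ⟨x - 1 - q, by omega⟩
    have r1 : c + 1 + q + 1 - 1 = c + 1 + q := by omega
    have r2 : c + 1 + q + 1 - 2 = c + q := by omega
    have r3 : c + 1 + q - 1 = c + q := by omega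
    simp only [r1, r2, r3] at hx hx' hy h1 h2
    have b1 : c + 1 + q ∈ T := hx.1
    have b2 : c + 1 + q + 1 ∈ T := hy.1
    have b3 : c + q ∉ T := hx.2.2
    have b4 : c + 1 + q + q ∉ T := by
      intro hT
      have := h1 (c + 1 + q + q) (Or.inr ⟨by omega, hT⟩) (by omega)
      rw [Nat.add_sub_cancel] at this
      rcases this with h | h
      · omega
      · exact h.1 rfl
    have b5 : c + 1 + q + 1 + q ∉ T := by
      intro hT
      have := h2 (c + 1 + q + 1 + q) (Or.inr ⟨by omega, hT⟩) (by omega)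
      rw [Nat.add_sub_cancel] at this
      rcases this with h | h
      · omega
      · exact h.1 rfl
    apply key (c + 1 + q) (c + 1 + q + 1) (by omega) (mem_Ends.2 ⟨b1, b4⟩) (mem_Ends.2 ⟨b2, b5⟩)
    intro t ht
    rw [mem_Ends] at ht
    have c1 : t ≠ c + q := fun h => b3 (h ▸ ht.1)
    have c2 : t ≠ c + 1 := fun h => ht.2 (h ▸ b1)
    have c3 : t ≠ c + 2 := fun h => ht.2 (by rw [h, show c + 2 + q = c + 1 + q + 1 by omega]; exact b2)
    clear key h1 h2 hm hlow hx hx' hy h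
    unfold shiftEnd
    split_ifs <;> omega

lemma card_goodEnds {a M n : ℕ} (h2 : 2 ≤ n) (hn : n < 2 ^ a) (hM : n + 2 ^ a ≤ M)
    {T : Finset ℕ} (hT : T ∈ GS M n) : (goodEnds (2 ^ a) T).card = 2 ^ a - 2 := by
  rw [mem_GS, mem_OS] at hT
  obtain ⟨⟨hc, hw, hd⟩, T1, T2, h01, h02, h1⟩ := hT
  have ha : 1 < a := by
    by_contra hlt
    have : 2 ^ a ≤ 2 ^ 1 := Nat.pow_le_pow_right (by norm_num) (by omega)
    omega
  have hq : 0 < 2 ^ a := by positivity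
  have w1 := h01.wt_eq
  have w2 := h02.wt_eq
  have hcore : IsCore (2 ^ a) T := isCore_of_wt_lt (by omega)
  have hcore1 : IsCore (2 ^ a) T1 := isCore_of_wt_lt (by omega)
  have hcore2 : IsCore (2 ^ a) T2 := isCore_of_wt_lt (by omega)
  obtain ⟨x, hx, rfl, hdx⟩ := h01
  obtain ⟨x', hx', rfl, hdx'⟩ := h02
  obtain ⟨y, hy, hxy, hdy⟩ := h1
  rw [hxy] at hdy
  have hres := card_filter_shiftEnd (q := 2 ^ a) (by omega) hx hx' hy hxy hcore1
    (by rw [pow_one] at hxy; rw [← hxy]; exact hcore2) (fun j hj => mem_of_lt (by omega))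
    (card_Ends hcore (by omega))
  rw [← hres]
  unfold goodEnds
  congr 1
  apply Finset.filter_congr
  intro t ht
  constructor
  · rintro ⟨S1, S2, g1, g2, g3⟩
    rw [Ch_up_iff (by omega) hd (by omega) ht hx hdx] at g1
    obtain ⟨e1, rfl⟩ := g1
    rw [Ch_up_iff (by omega) hdx (by omega) e1 hx' hdx'] at g2
    obtain ⟨e2, rfl⟩ := g2
    rw [Ch_up_iff (by omega) hd (by omega) ht hy hdy, ← hxy] at g3
    exact (up_inj hq hcore2 hcore2 e2 g3.1 g3.2).2
  · intro h
    obtain ⟨S1, h1⟩ := exists_Ch (k := 0) (S := up (2 ^ a) T t)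
      (by rw [dS_up hcore ht, hd]) (by rw [wt_up hq ht]; simp; omega)
    have e1 := ((Ch_up_iff (by omega) hd (by omega) ht hx hdx).1 h1).1
    obtain ⟨S2, h2⟩ := exists_Ch (k := 0) (S := S1) h1.dS_eq
      (by have := h1.wt_eq; rw [wt_up hq ht] at this; simp at this ⊢; omega)
    obtain ⟨S3, h3⟩ := exists_Ch (k := 1) (S := up (2 ^ a) T t)
      (by rw [dS_up hcore ht, hd]) (by rw [wt_up hq ht]; omega)
    refine ⟨S1, S2, h1, h2, ?_⟩
    have f1 := (Ch_up_iff (by omega) hd (by omega) ht hx hdx).1 h1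
    rw [f1.2] at h2
    have f2 := (Ch_up_iff (by omega) hdx (by omega) e1 hx' hdx').1 h2
    have f3 := (Ch_up_iff (by omega) hd (by omega) ht hy hdy).1 h3
    have : S2 = S3 := by
      rw [f2.2, f3.2, ← hxy]
      congr 1
    rw [this]
    exact h3

lemma good_of_good_up {a : ℕ} {T : Finset ℕ} {t : ℕ} (h2 : 2 ≤ wt T) (hw : wt T < 2 ^ a)
    (hd : dS T = 1) (ht : t ∈ Ends (2 ^ a) T) (h : Good (up (2 ^ a) T t)) : Good T := by
  have ha : 1 < a := by
    by_contra hlt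
    have : 2 ^ a ≤ 2 ^ 1 := Nat.pow_le_pow_right (by norm_num) (by omega)
    omega
  have hq : 0 < 2 ^ a := by positivity
  obtain ⟨T1, h1⟩ := exists_Ch (k := 0) hd (by simp; omega)
  have w1 := h1.wt_eq
  obtain ⟨T2, h2'⟩ := exists_Ch (k := 0) (S := T1) h1.dS_eq (by simp at w1 ⊢; omega)
  have w2 := h2'.wt_eq
  obtain ⟨T3, h3⟩ := exists_Ch (k := 1) hd (by simp; omega)
  have w3 := h3.wt_eq
  refine ⟨T1, T2, h1, h2', ?_⟩
  suffices T2 = T3 by rw [this]; exact h3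
  have hcore2 : IsCore (2 ^ a) T2 := isCore_of_wt_lt (by omega)
  have hcore3 : IsCore (2 ^ a) T3 := isCore_of_wt_lt (by omega)
  obtain ⟨x, hx, rfl, hdx⟩ := h1
  obtain ⟨x', hx', rfl, hdx'⟩ := h2'
  obtain ⟨y, hy, rfl, hdy⟩ := h3
  obtain ⟨S1, S2, g1, g2, g3⟩ := h
  rw [Ch_up_iff (by omega) hd (by omega) ht hx hdx] at g1
  obtain ⟨e1, rfl⟩ := g1
  rw [Ch_up_iff (by omega) hdx (by omega) e1 hx' hdx'] at g2
  obtain ⟨e2, rfl⟩ := g2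
  rw [Ch_up_iff (by omega) hd (by omega) ht hy hdy] at g3
  exact (up_inj hq hcore2 hcore3 e2 g3.1 g3.2).1

lemma card_GS {a M n : ℕ} (h2 : 2 ≤ n) (hn : n < 2 ^ a) (hM : n + 2 ^ a ≤ M) :
    (GS M (n + 2 ^ a)).card = (GS M n).card * (2 ^ a - 2) := by
  have hq : 0 < 2 ^ a := by positivity
  have hcore : ∀ T ∈ GS M n, IsCore (2 ^ a) T := fun T hT =>
    isCore_of_wt_lt (by rw [(mem_OS.1 (mem_GS.1 hT).1).2.1]; exact hn)
  rw [← card_biUnion_up hq (GS M n) (goodEnds (2 ^ a)) hcore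
    (fun T _ => Finset.filter_subset _ _) (fun T hT => card_goodEnds h2 hn hM hT)]
  congr 1
  ext S
  simp only [Finset.mem_biUnion, Finset.mem_image, goodEnds, Finset.mem_filter]
  constructor
  · intro hS
    rw [mem_GS, mem_OS] at hS
    obtain ⟨⟨h3, h4, h5⟩, h6⟩ := hS
    obtain ⟨T, t, hT, hdT, ht, rfl, hwT, hc⟩ := exists_up (a := a) h5 (by omega) (by omega)
    refine ⟨T, ?_, t, ⟨ht, h6⟩, rfl⟩
    rw [mem_GS, mem_OS]
    exact ⟨⟨by omega, by omega, hdT⟩, good_of_good_up (by omega) (by omega) hdT ht h6⟩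
  · rintro ⟨T, hT, t, ⟨ht, hg⟩, rfl⟩
    have hTc := hcore T hT
    rw [mem_GS, mem_OS] at hT ⊢
    rw [card_up hq ht, wt_up hq ht, dS_up hTc ht]
    exact ⟨⟨hT.1.1, by rw [hT.1.2.1], hT.1.2.2⟩, hg⟩

lemma insert_zero_image_succ_injective :
    Function.Injective (fun B : Finset ℕ => insert 0 (B.image Nat.succ)) := by
  intro B B' h
  ext z
  have : z + 1 ∈ insert 0 (B.image Nat.succ) ↔ z + 1 ∈ insert 0 (B'.image Nat.succ) := by
    rw [show insert 0 (B.image Nat.succ) = insert 0 (B'.image Nat.succ) from h]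
  simpa using this

lemma exists_mv_insert_zero {e : ℕ} (he : 0 < e) {B B' : Finset ℕ} :
    (∃ x ∈ Mov e (insert 0 (B.image Nat.succ)), insert 0 (B'.image Nat.succ) =
      mv e (insert 0 (B.image Nat.succ)) x) ↔ ∃ x ∈ Mov e B, B' = mv e B x := by
  have h0 : ∀ {y : ℕ} {C : Finset ℕ}, y + 1 ∈ insert 0 (C.image Nat.succ) ↔ y ∈ C := by
    intro y C
    simp
  have key : ∀ x, e ≤ x → insert 0 ((mv e B x).image Nat.succ) =
      mv e (insert 0 (B.image Nat.succ)) (x + 1) := by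
    intro x hx
    ext y
    rcases y with _ | y
    · simp [mem_mv]
    · rw [h0, mem_mv, mem_mv, h0, show y + 1 = x + 1 - e ↔ y = x - e by omega,
        show y + 1 ≠ x + 1 ↔ y ≠ x by omega]
  constructor
  · rintro ⟨x, hx, h⟩
    rw [mem_Mov] at hx
    obtain ⟨h1, h2, h3⟩ := hx
    have h4 : e < x := by
      rcases Nat.lt_or_eq_of_le h2 with h | h
      · exact h
      · simp [h] at h3
    obtain ⟨z, rfl⟩ : ∃ z, x = z + 1 := ⟨x - 1, by omega⟩
    rw [show z + 1 - e = z - e + 1 by omega, h0] at h3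
    rw [h0] at h1
    refine ⟨z, mem_Mov.2 ⟨h1, by omega, h3⟩, insert_zero_image_succ_injective ?_⟩
    rw [← key z (by omega)] at h
    exact h
  · rintro ⟨x, hx, rfl⟩
    rw [mem_Mov] at hx
    refine ⟨x + 1, mem_Mov.2 ⟨h0.2 hx.1, by omega, ?_⟩, key x hx.2.1⟩
    rw [show x + 1 - e = x - e + 1 by omega, h0]
    exact hx.2.2

lemma exists_mv_betaSet_add {e : ℕ} (he : 0 < e) {lam mu : Multiset ℕ} {m : ℕ}
    (h1 : Multiset.card lam ≤ m) (h2 : Multiset.card mu ≤ m) (j : ℕ) :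
    (∃ x ∈ Mov e (betaSet lam (m + j)), betaSet mu (m + j) = mv e (betaSet lam (m + j)) x) ↔
      ∃ x ∈ Mov e (betaSet lam m), betaSet mu m = mv e (betaSet lam m) x := by
  induction j with
  | zero => rfl
  | succ j ih =>
    rw [← ih, ← add_assoc, betaSet_succ (by omega), betaSet_succ (by omega),
      exists_mv_insert_zero he]

lemma wt_betaSet {lam : Multiset ℕ} (hpos : ∀ x ∈ lam, 0 < x) {m : ℕ}
    (h : Multiset.card lam ≤ m) : wt (betaSet lam m) = lam.sum := by
  unfold wt
  rw [partOfBeta_betaSet hpos h]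

lemma isHookRemoval_iff {e M : ℕ} (he : 0 < e) {lam mu : Multiset ℕ}
    (h1 : ∀ x ∈ lam, 0 < x) (h2 : ∀ x ∈ mu, 0 < x) (h3 : Multiset.card lam ≤ M)
    (h4 : Multiset.card mu ≤ M) :
    IsHookRemoval e lam mu ↔
      ∃ x ∈ Mov e (betaSet lam M), betaSet mu M = mv e (betaSet lam M) x := by
  constructor
  · rintro ⟨-, -, -, m, x, h5, h6, h7, h8, h9, h10⟩
    rw [← exists_mv_betaSet_add he h3 h4 m, add_comm, exists_mv_betaSet_add he h5 h6 M]
    exact ⟨x, mem_Mov.2 ⟨h7, h8, h9⟩, h10⟩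
  · rintro ⟨x, hx, h⟩
    rw [mem_Mov] at hx
    exact ⟨h1, h2, he, M, x, h3, h4, hx.1, hx.2.1, hx.2.2, h⟩

lemma IsHookRemoval.sum_add {e : ℕ} {lam mu : Multiset ℕ} (h : IsHookRemoval e lam mu) :
    mu.sum + e = lam.sum := by
  obtain ⟨h1, h2, -, m, x, h5, h6, h7, h8, h9, h10⟩ := h
  have := wt_mv (mem_Mov.2 ⟨h7, h8, h9⟩)
  rw [← wt_betaSet h1 h5, ← wt_betaSet h2 h6, h10]
  exact this

lemma isHookRemoval_and_oddP_iff {k M : ℕ} {lam mu : Multiset ℕ}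
    (h1 : ∀ x ∈ lam, 0 < x) (h3 : lam.sum ≤ M) :
    IsHookRemoval (2 ^ k) lam mu ∧ OddP mu ↔
      (∀ x ∈ mu, 0 < x) ∧ Multiset.card mu ≤ M ∧ Ch k (betaSet lam M) (betaSet mu M) := by
  have hc := card_le_sum h1
  have hk : 0 < 2 ^ k := by positivity
  constructor
  · rintro ⟨h, ho⟩
    have hs := h.sum_add
    have h2 := ho.1
    have hc2 := card_le_sum h2
    rw [isHookRemoval_iff hk h1 h2 (by omega : _ ≤ M) (by omega)] at h
    obtain ⟨x, hx, h⟩ := h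
    exact ⟨h2, by omega, x, hx, h, (odd_iff_dS h2 (by omega)).1 ho⟩
  · rintro ⟨h2, h4, x, hx, h, hd⟩
    rw [isHookRemoval_iff hk h1 h2 (by omega : _ ≤ M) h4]
    exact ⟨⟨x, hx, h⟩, (odd_iff_dS h2 h4).2 hd⟩

lemma Ch_betaSet_fkOp {k M : ℕ} {lam : Multiset ℕ} (ho : OddP lam) (hk : 2 ^ k ≤ lam.sum)
    (hM : lam.sum ≤ M) :
    OddP (fkOp k lam) ∧ (fkOp k lam).sum + 2 ^ k = lam.sum ∧
      Ch k (betaSet lam M) (betaSet (fkOp k lam) M) := by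
  have hc := card_le_sum ho.1
  have hex : ∃ mu, IsHookRemoval (2 ^ k) lam mu ∧ OddP mu := by
    obtain ⟨S', hS'⟩ := exists_Ch (k := k) ((odd_iff_dS ho.1 (by omega : _ ≤ M)).1 ho)
      (by rw [wt_betaSet ho.1 (by omega)]; exact hk)
    have hcard : S'.card = M := by rw [hS'.card_eq, card_betaSet (by omega)]
    refine ⟨partOfBeta S', ?_⟩
    have hb : betaSet (partOfBeta S') M = S' := by rw [← hcard, betaSet_partOfBeta]
    rw [isHookRemoval_and_oddP_iff ho.1 hM, hb]
    refine ⟨fun x hx => partOfBeta_pos hx, ?_, hS'⟩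
    rw [← hcard]
    exact card_partOfBeta_le S'
  have hspec : IsHookRemoval (2 ^ k) lam (fkOp k lam) ∧ OddP (fkOp k lam) := by
    unfold fkOp
    rw [dif_pos hex]
    exact hex.choose_spec
  exact ⟨hspec.2, hspec.1.sum_add, ((isHookRemoval_and_oddP_iff ho.1 hM).1 hspec).2.2⟩

lemma fkOp_fkOp_eq_iff {M : ℕ} {lam : Multiset ℕ} (ho : OddP lam) (h2 : 2 ≤ lam.sum)
    (hM : lam.sum ≤ M) :
    fkOp 0 (fkOp 0 lam) = fkOp 1 lam ↔ Good (betaSet lam M) := by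
  obtain ⟨o1, s1, c1⟩ := Ch_betaSet_fkOp (k := 0) ho (by simp; omega) hM
  obtain ⟨o2, s2, c2⟩ := Ch_betaSet_fkOp (k := 0) (M := M) o1 (by simp at *; omega) (by omega)
  obtain ⟨o3, s3, c3⟩ := Ch_betaSet_fkOp (k := 1) ho (by simp; omega) hM
  have hc := card_le_sum ho.1
  have hd := (odd_iff_dS ho.1 (by omega : _ ≤ M)).1 ho
  constructor
  · intro h
    refine ⟨_, _, c1, c2, ?_⟩
    rw [h]
    exact c3
  · rintro ⟨S1, S2, g1, g2, g3⟩
    have e1 := Ch_unique _ rfl hd c1 g1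
    subst e1
    have e2 := Ch_unique _ rfl c1.dS_eq c2 g2
    have e3 := Ch_unique _ rfl hd c3 g3
    have k2 := card_le_sum o2.1
    have k3 := card_le_sum o3.1
    rw [← partOfBeta_betaSet o2.1 (by omega : _ ≤ M), ← partOfBeta_betaSet o3.1 (by omega : _ ≤ M),
      e2, e3]

lemma bijOn_betaSet {M n : ℕ} (hn : n ≤ M) :
    Set.BijOn (fun lam => betaSet lam M) {lam : Multiset ℕ | OddP lam ∧ lam.sum = n}
      (OS M n : Set (Finset ℕ)) := by
  refine ⟨?_, ?_, ?_⟩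
  · rintro lam ⟨ho, rfl⟩
    have hc := card_le_sum ho.1
    have hc' : Multiset.card lam ≤ M := by omega
    exact Finset.mem_coe.2 (mem_OS.2 ⟨card_betaSet hc', wt_betaSet ho.1 hc',
      (odd_iff_dS ho.1 hc').1 ho⟩)
  · rintro lam ⟨ho, hl⟩ mu ⟨ho', hm⟩ h
    have hc := card_le_sum ho.1
    have hc' := card_le_sum ho'.1
    rw [← partOfBeta_betaSet ho.1 (by omega : _ ≤ M), ← partOfBeta_betaSet ho'.1 (by omega : _ ≤ M)]
    exact congrArg partOfBeta h
  · intro S hS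
    obtain ⟨h1, h2, h3⟩ := mem_OS.1 (Finset.mem_coe.1 hS)
    have hb : betaSet (partOfBeta S) M = S := by rw [← h1, betaSet_partOfBeta]
    refine ⟨partOfBeta S, ⟨?_, h2⟩, hb⟩
    rw [odd_iff_dS (fun x hx => partOfBeta_pos hx) (m := M) (by rw [← h1]; exact card_partOfBeta_le S),
      hb]
    exact h3

/-- The odd partitions of `n` on which `f₀ ∘ f₀` agrees with `f₁`. -/
abbrev goodOdd (n : ℕ) : Set (Multiset ℕ) :=
  {lam | OddP lam ∧ lam.sum = n ∧ fkOp 0 (fkOp 0 lam) = fkOp 1 lam}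

lemma bijOn_betaSet_good {M n : ℕ} (h2 : 2 ≤ n) (hn : n ≤ M) :
    Set.BijOn (fun lam => betaSet lam M) (goodOdd n) (GS M n : Set (Finset ℕ)) := by
  have hb := bijOn_betaSet hn
  refine ⟨?_, ?_, ?_⟩
  · rintro lam ⟨ho, hl, hf⟩
    have := hb.1 ⟨ho, hl⟩
    exact Finset.mem_coe.2 (mem_GS.2 ⟨Finset.mem_coe.1 this,
      (fkOp_fkOp_eq_iff ho (by omega) (by omega)).1 hf⟩)
  · rintro lam ⟨ho, hl, -⟩ mu ⟨ho', hm, -⟩ h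
    exact hb.2.1 ⟨ho, hl⟩ ⟨ho', hm⟩ h
  · intro S hS
    obtain ⟨h3, h4⟩ := mem_GS.1 (Finset.mem_coe.1 hS)
    obtain ⟨lam, ⟨ho, hl⟩, rfl⟩ := hb.2.2 (Finset.mem_coe.2 h3)
    exact ⟨lam, ⟨ho, hl, (fkOp_fkOp_eq_iff ho (by omega) (by omega)).2 h4⟩, rfl⟩

lemma Gnum_eq_card {M n : ℕ} (h2 : 2 ≤ n) (hn : n ≤ M) : Gnum 0 n = (GS M n).card := by
  rw [← Set.ncard_coe_finset, ← (bijOn_betaSet_good h2 hn).image_eq,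
    (bijOn_betaSet_good h2 hn).injOn.ncard_image]
  rfl

lemma Gnum_add_two_pow {a n : ℕ} (h2 : 2 ≤ n) (hn : n < 2 ^ a) :
    Gnum 0 (n + 2 ^ a) = Gnum 0 n * (2 ^ a - 2) := by
  rw [Gnum_eq_card (M := n + 2 ^ a) (by omega) le_rfl, Gnum_eq_card h2 (Nat.le_add_right n (2 ^ a)),
    card_GS h2 hn le_rfl]

@[to_additive]
lemma prod_Icc_succ_bot {M : Type*} [CommMonoid M] (f : ℕ → M) (k : ℕ) :
    ∏ i ∈ Finset.Icc 1 (k + 1), f i = f 1 * ∏ i ∈ Finset.Icc 1 k, f (i + 1) := by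
  induction k with
  | zero => simp
  | succ k ih =>
    rw [Finset.prod_Icc_succ_top (by omega), ih, Finset.prod_Icc_succ_top (by omega), mul_assoc]

lemma Gnum_sum_two_pow {ε : ℕ} (hε : ε ≤ 1) (r : ℕ) (a : ℕ → ℕ)
    (hdec : ∀ i j, 1 ≤ i → i < j → j ≤ r + 1 → a j < a i) (hpos : 0 < a (r + 1)) :
    (∑ i ∈ Finset.Icc 1 (r + 1), 2 ^ a i) + ε < 2 ^ (a 1 + 1) ∧
      2 ≤ (∑ i ∈ Finset.Icc 1 (r + 1), 2 ^ a i) + ε ∧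
    Gnum 0 ((∑ i ∈ Finset.Icc 1 (r + 1), 2 ^ a i) + ε) =
      Gnum 0 (2 ^ a (r + 1) + ε) * ∏ j ∈ Finset.Icc 1 r, (2 ^ a j - 2) := by
  induction r generalizing a with
  | zero =>
    have : 2 ^ 1 ≤ 2 ^ a 1 := Nat.pow_le_pow_right (by norm_num) hpos
    simp [pow_succ]
    omega
  | succ r ih =>
    obtain ⟨h1, h2, h3⟩ := ih (fun i => a (i + 1))
      (fun i j hi hij hj => hdec (i + 1) (j + 1) (by omega) (by omega) (by omega)) hpos
    have ha : 2 ^ (a (1 + 1) + 1) ≤ 2 ^ a 1 :=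
      Nat.pow_le_pow_right (by norm_num) (hdec 1 2 (by omega) (by omega) (by omega))
    rw [sum_Icc_succ_bot, prod_Icc_succ_bot, pow_succ]
    refine ⟨by omega, by omega, ?_⟩
    rw [add_assoc, add_comm, Gnum_add_two_pow h2 (by omega), h3]
    ring

/-- The beta-set with `M` beads of the hook partition of `n` with leg length `b`. -/
def hookSet (M n b : ℕ) : Finset ℕ := up n (Finset.range M) (M - 1 - b)

lemma mem_hookSet {M n b y : ℕ} :
    y ∈ hookSet M n b ↔ y = M - 1 - b + n ∨ (y ≠ M - 1 - b ∧ y < M) := by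
  simp [hookSet, mem_up]

lemma isCore_range (q M : ℕ) : IsCore q (Finset.range M) := by
  intro x hx _
  rw [Finset.mem_range] at hx ⊢
  omega

lemma mem_Ends_range {M n b : ℕ} (hb : b < n) (hM : n ≤ M) :
    M - 1 - b ∈ Ends n (Finset.range M) := by
  rw [mem_Ends, Finset.mem_range, Finset.mem_range]
  omega

lemma Mov_hookSet_self {M n b : ℕ} (hb : b < n) (hM : n ≤ M) :
    M - 1 - b + n ∈ Mov n (hookSet M n b) ∧
      mv n (hookSet M n b) (M - 1 - b + n) = Finset.range M :=
  ⟨mem_Mov_up (by omega), mv_up (mem_Ends_range hb hM)⟩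

lemma card_hookSet {M n b : ℕ} (hb : b < n) (hM : n ≤ M) : (hookSet M n b).card = M := by
  rw [hookSet, card_up (by omega) (mem_Ends_range hb hM), Finset.card_range]

lemma wt_hookSet {M n b : ℕ} (hb : b < n) (hM : n ≤ M) : wt (hookSet M n b) = n := by
  rw [hookSet, wt_up (by omega) (mem_Ends_range hb hM), wt_range, zero_add]

lemma Mov_hookSet_arm {M n b e : ℕ} (he : 0 < e) (hb : b + e < n) (hM : n ≤ M) :
    M - 1 - b + n ∈ Mov e (hookSet M n b) ∧
      mv e (hookSet M n b) (M - 1 - b + n) = hookSet M (n - e) b := by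
  constructor
  · rw [mem_Mov, mem_hookSet, mem_hookSet]
    omega
  · ext y
    rw [mem_mv, mem_hookSet, mem_hookSet]
    omega

lemma Mov_hookSet_leg {M n b e : ℕ} (he : 0 < e) (hb : e ≤ b) (hbn : b < n) (hM : n ≤ M) :
    M - 1 - b + e ∈ Mov e (hookSet M n b) ∧
      mv e (hookSet M n b) (M - 1 - b + e) = hookSet M (n - e) (b - e) := by
  constructor
  · rw [mem_Mov, mem_hookSet, mem_hookSet]
    omega
  · ext y
    rw [mem_mv, mem_hookSet, mem_hookSet]
    omega

lemma dS_hookSet {M : ℕ} (n : ℕ) : ∀ b, b ≤ n → n + 1 ≤ M →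
    dS (hookSet M (n + 1) b) = (n.choose b : ZMod 2) := by
  induction n with
  | zero =>
    intro b hb hM
    obtain rfl : b = 0 := by omega
    rw [hookSet, show (0 + 1 : ℕ) = 2 ^ 0 from rfl,
      dS_up (isCore_range _ _) (mem_Ends_range (by omega) (by simpa using hM)), dS_range]
    simp
  | succ n ih =>
    intro b hb hM
    rw [dS_rec (by rw [wt_hookSet (by omega) hM]; omega)]
    have hmov : ∀ x, x ∈ Mov 1 (hookSet M (n + 1 + 1) b) ↔
        (b + 1 < n + 1 + 1 ∧ x = M - 1 - b + (n + 1 + 1)) ∨ (1 ≤ b ∧ x = M - 1 - b + 1) := by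
      intro x
      rw [mem_Mov, mem_hookSet, mem_hookSet]
      omega
    rcases b with _ | b
    · have : Mov 1 (hookSet M (n + 1 + 1) 0) = {M - 1 - 0 + (n + 1 + 1)} := by
        ext x
        rw [hmov, Finset.mem_singleton]
        omega
      rw [this, Finset.sum_singleton, (Mov_hookSet_arm (by omega) (by omega) hM).2,
        Nat.add_sub_cancel, ih 0 (by omega) (by omega)]
      simp
    · rcases Nat.lt_or_ge n (b + 1) with h | h
      · have : Mov 1 (hookSet M (n + 1 + 1) (b + 1)) = {M - 1 - (b + 1) + 1} := by
          ext x
          rw [hmov, Finset.mem_singleton]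
          omega
        rw [this, Finset.sum_singleton, (Mov_hookSet_leg (by omega) (by omega) (by omega) hM).2,
          Nat.add_sub_cancel, Nat.add_sub_cancel, ih b (by omega) (by omega), Nat.choose_succ_succ,
          Nat.choose_eq_zero_of_lt h, add_zero]
      · have : Mov 1 (hookSet M (n + 1 + 1) (b + 1)) =
            {M - 1 - (b + 1) + 1, M - 1 - (b + 1) + (n + 1 + 1)} := by
          ext x
          rw [hmov, Finset.mem_insert, Finset.mem_singleton]
          omega
        rw [this, Finset.sum_pair (by omega),
          (Mov_hookSet_leg (by omega) (by omega) (by omega) hM).2,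
          (Mov_hookSet_arm (by omega) (by omega) hM).2,
          Nat.add_sub_cancel, Nat.add_sub_cancel, ih b (by omega) (by omega),
          ih (b + 1) (by omega) (by omega), Nat.choose_succ_succ]
        push_cast
        rfl

lemma dS_hookSet_eq_one {M n b : ℕ} (hb : b < n) (hM : n ≤ M) (h : Odd ((n - 1).choose b)) :
    dS (hookSet M n b) = 1 := by
  obtain ⟨n, rfl⟩ : ∃ k, n = k + 1 := ⟨n - 1, by omega⟩
  rw [dS_hookSet n b (by omega) hM, ZMod.natCast_eq_one_iff_odd]
  exact h

lemma dS_hookSet_two_pow {M a b : ℕ} (hb : b < 2 ^ a) (hM : 2 ^ a ≤ M) :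
    dS (hookSet M (2 ^ a) b) = 1 := by
  rw [hookSet, dS_up (isCore_range _ _) (mem_Ends_range hb hM), dS_range]

lemma Ch_hookSet_arm {M n b k : ℕ} (hb : b + 2 ^ k < n) (hM : n ≤ M)
    (h : Odd ((n - 2 ^ k - 1).choose b)) : Ch k (hookSet M n b) (hookSet M (n - 2 ^ k) b) := by
  obtain ⟨h1, h2⟩ := Mov_hookSet_arm (by positivity : 0 < 2 ^ k) hb hM
  exact ⟨_, h1, h2.symm, dS_hookSet_eq_one (by omega) ((Nat.sub_le n _).trans hM) h⟩

lemma Ch_hookSet_leg {M n b k : ℕ} (hb : 2 ^ k ≤ b) (hbn : b < n) (hM : n ≤ M)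
    (h : Odd ((n - 2 ^ k - 1).choose (b - 2 ^ k))) :
    Ch k (hookSet M n b) (hookSet M (n - 2 ^ k) (b - 2 ^ k)) := by
  obtain ⟨h1, h2⟩ := Mov_hookSet_leg (by positivity : 0 < 2 ^ k) hb hbn hM
  exact ⟨_, h1, h2.symm, dS_hookSet_eq_one (by omega) ((Nat.sub_le n _).trans hM) h⟩

lemma Ch_hookSet_self {M b k : ℕ} (hb : b < 2 ^ k) (hM : 2 ^ k ≤ M) :
    Ch k (hookSet M (2 ^ k) b) (Finset.range M) := by
  obtain ⟨h1, h2⟩ := Mov_hookSet_self hb hM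
  exact ⟨_, h1, h2.symm, dS_range M⟩

lemma good_row {M n : ℕ} (h2 : 2 ≤ n) (hM : n ≤ M) : Good (hookSet M n 0) := by
  rcases Nat.lt_or_eq_of_le h2 with h | rfl
  · refine ⟨hookSet M (n - 1) 0, hookSet M (n - 2) 0, ?_, ?_, ?_⟩
    · exact Ch_hookSet_arm (k := 0) (by omega) hM (by simp)
    · exact Ch_hookSet_arm (k := 0) (n := n - 1) (by omega) (by omega) (by simp)
    · exact Ch_hookSet_arm (k := 1) (by omega) hM (by simp)
  · exact ⟨hookSet M 1 0, Finset.range M, Ch_hookSet_arm (k := 0) (by omega) hM (by simp),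
      Ch_hookSet_self (k := 0) (by omega) (by omega),
      Ch_hookSet_self (k := 1) (by omega) (by omega)⟩

lemma good_col {M n : ℕ} (h2 : 2 ≤ n) (hM : n ≤ M) : Good (hookSet M n (n - 1)) := by
  rcases Nat.lt_or_eq_of_le h2 with h | rfl
  · refine ⟨hookSet M (n - 1) (n - 2), hookSet M (n - 2) (n - 3), ?_, ?_, ?_⟩
    · exact Ch_hookSet_leg (k := 0) (b := n - 1) (by omega) (by omega) hM
        (by simp [show n - 1 - 1 = n - 2 by omega])
    · exact Ch_hookSet_leg (k := 0) (n := n - 1) (b := n - 2) (by omega) (by omega) (by omega)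
        (by simp [show n - 1 - 1 - 1 = n - 2 - 1 by omega])
    · exact Ch_hookSet_leg (k := 1) (b := n - 1) (by omega) (by omega) hM
        (by simp [show n - 2 - 1 = n - 1 - 2 by omega])
  · exact ⟨hookSet M 1 0, Finset.range M,
      Ch_hookSet_leg (k := 0) (b := 1) (by omega) (by omega) hM (by simp),
      Ch_hookSet_self (k := 0) (by omega) (by omega),
      Ch_hookSet_self (k := 1) (by omega) (by omega)⟩

lemma hookSet_mem_OS {M n b : ℕ} (hb : b < n) (hM : n ≤ M) (h : Odd ((n - 1).choose b)) :
    hookSet M n b ∈ OS M n :=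
  mem_OS.2 ⟨card_hookSet hb hM, wt_hookSet hb hM, dS_hookSet_eq_one hb hM h⟩

lemma hookSet_ne {M n b c : ℕ} (hb : b < n) (hM : n ≤ M) (hc : c < n) (h : b ≠ c) :
    hookSet M n b ≠ hookSet M n c := by
  intro heq
  have h1 : M - 1 - b ∈ hookSet M n c := mem_hookSet.2 (by omega)
  rw [← heq, mem_hookSet] at h1
  omega

lemma row_mem_GS {M n : ℕ} (h2 : 2 ≤ n) (hM : n ≤ M) : hookSet M n 0 ∈ GS M n :=
  mem_GS.2 ⟨hookSet_mem_OS (by omega) hM (by simp), good_row h2 hM⟩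

lemma col_mem_GS {M n : ℕ} (h2 : 2 ≤ n) (hM : n ≤ M) : hookSet M n (n - 1) ∈ GS M n :=
  mem_GS.2 ⟨hookSet_mem_OS (by omega) hM (by simp), good_col h2 hM⟩

lemma two_le_card_GS {M n : ℕ} (h2 : 2 ≤ n) (hM : n ≤ M) : 2 ≤ (GS M n).card := by
  rw [← Finset.card_pair (hookSet_ne (b := 0) (c := n - 1) (by omega) hM (by omega) (by omega))]
  apply Finset.card_le_card
  simp [Finset.insert_subset_iff, row_mem_GS h2 hM, col_mem_GS h2 hM]

lemma betaSet_singleton {n M : ℕ} (hM : 0 < M) : betaSet {n} M = hookSet M n 0 := by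
  obtain ⟨m, rfl⟩ : ∃ m, M = m + 1 := ⟨M - 1, by omega⟩
  rw [← Multiset.cons_zero, betaSet_cons (by simp), betaSet_zero]
  ext y
  rw [mem_hookSet, Finset.mem_insert, Finset.mem_range]
  omega

lemma betaSet_replicate_one (n : ℕ) : ∀ {M : ℕ}, n ≤ M →
    betaSet (Multiset.replicate n 1) M = (Finset.range (M + 1)).erase (M - n) := by
  induction n with
  | zero =>
    intro M _
    rw [Multiset.replicate_zero, betaSet_zero]
    ext y
    rw [Finset.mem_erase, Finset.mem_range, Finset.mem_range]
    omega
  | succ n ih =>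
    intro M hM
    obtain ⟨m, rfl⟩ : ∃ m, M = m + 1 := ⟨M - 1, by omega⟩
    rw [Multiset.replicate_succ,
      betaSet_cons (fun x hx => (Multiset.eq_of_mem_replicate hx).le), ih (by omega)]
    ext y
    rw [Finset.mem_insert, Finset.mem_erase, Finset.mem_range, Finset.mem_erase, Finset.mem_range]
    omega

lemma betaSet_replicate {n M : ℕ} (hn : 0 < n) (hM : n ≤ M) :
    betaSet (Multiset.replicate n 1) M = hookSet M n (n - 1) := by
  rw [betaSet_replicate_one n hM]
  ext y
  rw [mem_hookSet, Finset.mem_erase, Finset.mem_range]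
  omega

lemma singleton_mem_goodOdd {m : ℕ} (h2 : 2 ≤ m) : ({m} : Multiset ℕ) ∈ goodOdd m := by
  have hpos : ∀ x ∈ ({m} : Multiset ℕ), 0 < x := by
    intro x hx
    rw [Multiset.mem_singleton] at hx
    omega
  have hb := betaSet_singleton (n := m) (M := m) (by omega)
  have ho : OddP {m} := by
    rw [odd_iff_dS hpos (m := m) (by simp; omega), hb]
    exact dS_hookSet_eq_one (by omega) le_rfl (by simp)
  refine ⟨ho, by simp, ?_⟩
  rw [fkOp_fkOp_eq_iff (M := m) ho (by simpa using h2) (by simp), hb]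
  exact good_row h2 le_rfl

lemma replicate_mem_goodOdd {m : ℕ} (h2 : 2 ≤ m) : Multiset.replicate m 1 ∈ goodOdd m := by
  have hpos : ∀ x ∈ Multiset.replicate m 1, 0 < x := by
    intro x hx
    rw [Multiset.eq_of_mem_replicate hx]
    omega
  have hb := betaSet_replicate (n := m) (M := m) (by omega) le_rfl
  have ho : OddP (Multiset.replicate m 1) := by
    rw [odd_iff_dS hpos (m := m) (by simp), hb]
    exact dS_hookSet_eq_one (by omega) le_rfl (by simp)
  refine ⟨ho, by simp, ?_⟩
  rw [fkOp_fkOp_eq_iff (M := m) ho (by simpa using h2) (by simp), hb]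
  exact good_col h2 le_rfl

lemma goodOdd_eq_pair_iff {m : ℕ} (h2 : 2 ≤ m) :
    goodOdd m = {({m} : Multiset ℕ), Multiset.replicate m 1} ↔ (GS m m).card = 2 := by
  have hne : ({m} : Multiset ℕ) ≠ Multiset.replicate m 1 := by
    intro h
    have := congrArg Multiset.card h
    simp at this
    omega
  have hcard : (goodOdd m).ncard = (GS m m).card := Gnum_eq_card h2 le_rfl
  rw [← hcard]
  constructor
  · intro h
    rw [h, Set.ncard_pair hne]
  · intro h
    refine (Set.eq_of_subset_of_ncard_le ?_ ?_ ?_).symm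
    · rintro x (rfl | rfl)
      · exact singleton_mem_goodOdd h2
      · exact replicate_mem_goodOdd h2
    · rw [h, Set.ncard_pair hne]
    · exact Set.finite_of_ncard_pos (by omega)

lemma goodOdd_eq_iff {m : ℕ} (h2 : 2 ≤ m) :
    goodOdd m = {lam : Multiset ℕ | OddP lam ∧ lam.sum = m} ↔ GS m m = OS m m := by
  constructor
  · intro h
    have h1 := (bijOn_betaSet_good h2 (le_refl m)).image_eq
    rw [h, (bijOn_betaSet (le_refl m)).image_eq] at h1
    exact_mod_cast h1.symm
  · intro h
    ext lam
    refine ⟨fun hl => ⟨hl.1, hl.2.1⟩, fun hl => ⟨hl.1, hl.2, ?_⟩⟩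
    have := Finset.mem_coe.1 ((bijOn_betaSet (le_refl m)).1 hl)
    rw [← h, mem_GS] at this
    have hs := hl.2
    exact (fkOp_fkOp_eq_iff hl.1 (by omega) (by omega)).2 this.2

lemma card_OS_zero (M : ℕ) : (OS M 0).card = 1 := by
  rw [Finset.card_eq_one]
  refine ⟨Finset.range M, ?_⟩
  ext S
  rw [mem_OS, Finset.mem_singleton]
  constructor
  · rintro ⟨h1, h2, -⟩
    rw [eq_range_of_wt_eq_zero h2, h1]
  · rintro rfl
    exact ⟨Finset.card_range M, wt_range M, dS_range M⟩

lemma card_OS_one {M : ℕ} (hM : 1 ≤ M) : (OS M 1).card = 1 := by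
  have := card_OS (a := 0) (n := 0) (M := M) (by norm_num) (by simpa using hM)
  rw [card_OS_zero] at this
  simpa using this

lemma not_good_hookSet_one {a : ℕ} (ha : 2 ≤ a) :
    ¬ Good (hookSet (2 ^ a) (2 ^ a) 1) := by
  have hq : 2 ^ 2 ≤ 2 ^ a := Nat.pow_le_pow_right (by norm_num) ha
  rintro ⟨S1, S2, h1, h2, h3⟩
  have hd := dS_hookSet_two_pow (b := 1) (a := a) (M := 2 ^ a) (by omega) le_rfl
  have e1 := Ch_unique _ rfl hd h1
    (Ch_hookSet_leg (k := 0) (b := 1) le_rfl (by omega) le_rfl (by simp))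
  subst e1
  have e2 := Ch_unique _ rfl h1.dS_eq h2
    (Ch_hookSet_arm (k := 0) (b := 1 - 2 ^ 0) (by simp; omega) (Nat.sub_le _ _) (by simp))
  subst e2
  obtain ⟨x, -, hx, -⟩ := h3
  have m1 := Finset.ext_iff.1 hx (2 ^ a - 1)
  have m2 := Finset.ext_iff.1 hx (2 ^ a - 2 + 2 ^ a)
  simp only [mem_mv, mem_hookSet] at m1 m2
  omega

lemma not_good_hookSet_four : ¬ Good (hookSet 4 4 2) := by
  rintro ⟨S1, S2, h1, h2, h3⟩
  have hd := dS_hookSet_two_pow (b := 2) (a := 2) (M := 4) (by norm_num) le_rfl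
  have e1 := Ch_unique _ rfl hd h1
    (Ch_hookSet_arm (k := 0) (b := 2) (n := 4) (by norm_num) le_rfl (by decide))
  subst e1
  have e2 := Ch_unique _ rfl h1.dS_eq h2
    (Ch_hookSet_leg (k := 0) (n := 3) (b := 2) (by norm_num) (by norm_num) (by norm_num) (by decide))
  subst e2
  obtain ⟨x, -, hx, -⟩ := h3
  have m1 := Finset.ext_iff.1 hx 5
  have m2 := Finset.ext_iff.1 hx 2
  simp only [mem_mv, mem_hookSet, true_or, and_true] at m1 m2
  omega

lemma good_hookSet_three {a : ℕ} (ha : 3 ≤ a) : Good (hookSet (2 ^ a) (2 ^ a) 3) := by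
  obtain ⟨b, rfl⟩ : ∃ b, a = b + 3 := ⟨a - 3, by omega⟩
  obtain ⟨c, hc⟩ : ∃ c, 2 ^ (b + 3) = 4 * (c + 2) := by
    refine ⟨2 ^ (b + 1) - 2, ?_⟩
    have : 2 ^ 1 ≤ 2 ^ (b + 1) := Nat.pow_le_pow_right (by norm_num) (by omega)
    simp only [pow_succ] at *
    omega
  rw [hc]
  have o2 : Odd ((4 * (c + 2) - 2).choose 2) := by
    rw [Nat.choose_two_right, show (4 * (c + 2) - 2) * (4 * (c + 2) - 2 - 1) =
      2 * ((2 * (c + 1) + 1) * (2 * (2 * c + 2) + 1)) by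
        rw [show 4 * (c + 2) - 2 - 1 = 2 * (2 * c + 2) + 1 by omega,
          show 4 * (c + 2) - 2 = 2 * (2 * (c + 1) + 1) by omega]
        ring, Nat.mul_div_cancel_left _ (by norm_num)]
    exact (odd_two_mul_add_one _).mul (odd_two_mul_add_one _)
  have o1 : Odd ((4 * (c + 2) - 3).choose 1) := by
    rw [Nat.choose_one_right]
    exact ⟨2 * c + 2, by omega⟩
  refine ⟨hookSet (4 * (c + 2)) (4 * (c + 2) - 1) 2, hookSet (4 * (c + 2)) (4 * (c + 2) - 2) 1,
    ?_, ?_, ?_⟩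
  · exact Ch_hookSet_leg (k := 0) (b := 3) (by norm_num) (by omega) le_rfl o2
  · exact Ch_hookSet_leg (k := 0) (n := 4 * (c + 2) - 1) (b := 2) (by norm_num) (by omega) (by omega) o1
  · exact Ch_hookSet_leg (k := 1) (b := 3) (by norm_num) (by omega) le_rfl o1

/-- The beta-sets with `q + 1` beads obtained from that of the partition of `1` by moving the
bead `t` up by `q`. -/
def liftOne (q t : ℕ) : Finset ℕ := up q (hookSet (q + 1) 1 0) t

lemma mem_liftOne {q t y : ℕ} :
    y ∈ liftOne q t ↔ y = t + q ∨ y ≠ t ∧ (y = q + 1 ∨ y < q) := by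
  rw [liftOne, mem_up, mem_hookSet]
  omega

lemma liftOne_mem_OS {a t : ℕ} (ha : 0 < a) (ht : t < 2 ^ a) (h1 : t ≠ 1) :
    liftOne (2 ^ a) t ∈ OS (2 ^ a + 1) (2 ^ a + 1) := by
  have hq : 2 ^ 1 ≤ 2 ^ a := Nat.pow_le_pow_right (by norm_num) ha
  have hE : t ∈ Ends (2 ^ a) (hookSet (2 ^ a + 1) 1 0) := by
    rw [mem_Ends, mem_hookSet, mem_hookSet]
    omega
  have hw : wt (hookSet (2 ^ a + 1) 1 0) = 1 := wt_hookSet (by norm_num) (by omega)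
  rw [mem_OS, liftOne, card_up (by omega) hE, wt_up (by omega) hE, hw,
    dS_up (isCore_of_wt_lt (by omega)) hE, card_hookSet (by norm_num) (by omega)]
  exact ⟨rfl, add_comm _ _, dS_hookSet_eq_one (by norm_num) (by omega) (by simp)⟩

lemma Ch_liftOne {a b : ℕ} (hb : 0 < b) (hb2 : b + 1 < 2 ^ a) :
    Ch 0 (liftOne (2 ^ a) (2 ^ a - b)) (hookSet (2 ^ a + 1) (2 ^ a) b) := by
  refine ⟨2 ^ a + 1, ?_, ?_, dS_hookSet_two_pow (by omega) (by omega)⟩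
  · rw [pow_zero, mem_Mov, mem_liftOne, mem_liftOne]
    omega
  · ext y
    rw [pow_zero, mem_mv, mem_liftOne, mem_hookSet]
    omega

lemma not_good_liftOne {a : ℕ} (ha : 3 ≤ a) : ¬ Good (liftOne (2 ^ a) (2 ^ a - 2)) := by
  have hq : 2 ^ 3 ≤ 2 ^ a := Nat.pow_le_pow_right (by norm_num) ha
  rintro ⟨S1, S2, h1, h2, h3⟩
  have hd := (mem_OS.1 (liftOne_mem_OS (a := a) (t := 2 ^ a - 2) (by omega) (by omega) (by omega))).2.2
  have e1 := Ch_unique _ rfl hd h1 (Ch_liftOne (b := 2) (by norm_num) (by omega))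
  subst e1
  obtain ⟨x, hx, rfl, -⟩ := h2
  obtain ⟨y, hy, hxy, -⟩ := h3
  have m1 := Finset.ext_iff.1 hxy (2 ^ a + 1)
  rw [pow_one] at hy m1
  rw [pow_zero] at hx m1
  simp only [mem_Mov, mem_mv, mem_liftOne, mem_hookSet, true_or, and_true] at hx hy m1
  omega

lemma good_liftOne {a : ℕ} (ha : 2 ≤ a) : Good (liftOne (2 ^ a) (2 ^ a - 1)) := by
  have hq : 2 ^ 2 ≤ 2 ^ a := Nat.pow_le_pow_right (by norm_num) ha
  refine ⟨_, hookSet (2 ^ a + 1) (2 ^ a - 1) 0, Ch_liftOne (b := 1) (by norm_num) (by omega),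
    Ch_hookSet_leg (k := 0) (b := 1) le_rfl (by omega) (by omega) (by simp), 2 ^ a + 1, ?_, ?_,
    dS_hookSet_eq_one (by omega) (by omega) (by simp)⟩
  · rw [pow_one, mem_Mov, mem_liftOne, mem_liftOne]
    omega
  · ext y
    rw [pow_one, mem_mv, mem_liftOne, mem_hookSet]
    omega

lemma good_liftOne_four : Good (liftOne 4 2) := by
  refine ⟨_, hookSet 5 3 2, Ch_liftOne (a := 2) (b := 2) (by norm_num) (by norm_num),
    Ch_hookSet_arm (k := 0) (n := 4) (b := 2) (by norm_num) (by norm_num) (by decide), 6, ?_, ?_,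
    dS_hookSet_eq_one (by norm_num) (by norm_num) (by decide)⟩
  · rw [pow_one, mem_Mov, mem_liftOne, mem_liftOne]
    omega
  · ext y
    rw [pow_one, mem_mv, mem_liftOne, mem_hookSet]
    omega

lemma GS_subset_OS (M n : ℕ) : GS M n ⊆ OS M n := Finset.filter_subset _ _

lemma three_le_card_of_mem {α : Type*} {s : Finset α} {x y z : α} (hx : x ∈ s) (hy : y ∈ s)
    (hz : z ∈ s) (hxy : x ≠ y) (hxz : x ≠ z) (hyz : y ≠ z) : 3 ≤ s.card := by
  have := Finset.two_lt_card.2 ⟨x, hx, y, hy, z, hz, hxy, hxz, hyz⟩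
  omega

lemma hookSet_ne_liftOne {q n b t : ℕ} (h2 : 2 < q) (hn : n = q + 1)
    (h0 : 0 < t) (ht : t < q) : hookSet (q + 1) n b ≠ liftOne q t := by
  intro h
  have m1 := Finset.ext_iff.1 h 0
  have m2 := Finset.ext_iff.1 h (q + 1)
  simp only [mem_liftOne, mem_hookSet, true_or, and_true] at m1 m2
  omega

lemma card_GS_two_pow {a : ℕ} (ha : 0 < a) :
    (GS (2 ^ a) (2 ^ a) = OS (2 ^ a) (2 ^ a) ↔ a = 1) ∧
      ((GS (2 ^ a) (2 ^ a)).card = 2 ↔ a ≤ 2) := by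
  have hq : 2 ^ 1 ≤ 2 ^ a := Nat.pow_le_pow_right (by norm_num) ha
  have hc := card_OS (a := a) (n := 0) (M := 2 ^ a) (by positivity) (by omega)
  rw [card_OS_zero, one_mul, zero_add] at hc
  have h2 := two_le_card_GS hq (le_refl (2 ^ a))
  have hsub := GS_subset_OS (2 ^ a) (2 ^ a)
  have hle := Finset.card_le_card hsub
  have hbad : 2 ≤ a → hookSet (2 ^ a) (2 ^ a) 1 ∈ OS (2 ^ a) (2 ^ a) \ GS (2 ^ a) (2 ^ a) := by
    intro h
    have hq : 2 ^ 2 ≤ 2 ^ a := Nat.pow_le_pow_right (by norm_num) h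
    rw [Finset.mem_sdiff, mem_GS, mem_OS]
    exact ⟨⟨card_hookSet (by omega) le_rfl, wt_hookSet (by omega) le_rfl,
      dS_hookSet_two_pow (by omega) le_rfl⟩, fun h' => not_good_hookSet_one h h'.2⟩
  constructor
  · constructor
    · intro h
      by_contra hne
      have := hbad (by omega)
      rw [h, Finset.sdiff_self] at this
      simp at this
    · rintro rfl
      exact Finset.eq_of_subset_of_card_le hsub (by omega)
  · constructor
    · intro h
      by_contra hlt
      have hq : 2 ^ 3 ≤ 2 ^ a := Nat.pow_le_pow_right (by norm_num) (by omega)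
      have h3 : hookSet (2 ^ a) (2 ^ a) 3 ∈ GS (2 ^ a) (2 ^ a) := by
        rw [mem_GS, mem_OS]
        exact ⟨⟨card_hookSet (by omega) le_rfl, wt_hookSet (by omega) le_rfl,
          dS_hookSet_two_pow (by omega) le_rfl⟩, good_hookSet_three (by omega)⟩
      have := three_le_card_of_mem (row_mem_GS (by omega) le_rfl) (col_mem_GS (by omega) le_rfl) h3
        (hookSet_ne (by omega) le_rfl (by omega) (by omega))
        (hookSet_ne (by omega) le_rfl (by omega) (by omega))
        (hookSet_ne (by omega) le_rfl (by omega) (by omega))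
      omega
    · intro h
      rcases (by omega : a = 1 ∨ a = 2) with rfl | rfl
      · omega
      · have hb2 : hookSet (2 ^ 2) (2 ^ 2) 2 ∈ OS (2 ^ 2) (2 ^ 2) \ GS (2 ^ 2) (2 ^ 2) := by
          rw [Finset.mem_sdiff, mem_GS, mem_OS]
          exact ⟨⟨card_hookSet (by norm_num) le_rfl, wt_hookSet (by norm_num) le_rfl,
            dS_hookSet_two_pow (by norm_num) le_rfl⟩, fun h' => not_good_hookSet_four h'.2⟩
        have h3 := Finset.one_lt_card.2 ⟨_, hbad le_rfl, _, hb2,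
          hookSet_ne (by norm_num) le_rfl (by norm_num) (by norm_num)⟩
        rw [Finset.card_sdiff_of_subset hsub] at h3
        omega

lemma card_GS_two_pow_add_one {a : ℕ} (ha : 0 < a) :
    (GS (2 ^ a + 1) (2 ^ a + 1) = OS (2 ^ a + 1) (2 ^ a + 1) ↔ a ≤ 2) ∧
      ((GS (2 ^ a + 1) (2 ^ a + 1)).card = 2 ↔ a = 1) := by
  have hq : 2 ^ 1 ≤ 2 ^ a := Nat.pow_le_pow_right (by norm_num) ha
  have hc := card_OS (a := a) (n := 1) (M := 2 ^ a + 1) (by omega) (by omega)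
  rw [card_OS_one (by omega), one_mul, add_comm 1] at hc
  have h2 := two_le_card_GS (n := 2 ^ a + 1) (by omega) le_rfl
  have hsub := GS_subset_OS (2 ^ a + 1) (2 ^ a + 1)
  have hle := Finset.card_le_card hsub
  have hrow := row_mem_GS (n := 2 ^ a + 1) (by omega) le_rfl
  have hcol := col_mem_GS (n := 2 ^ a + 1) (by omega) le_rfl
  have hne := hookSet_ne (M := 2 ^ a + 1) (n := 2 ^ a + 1) (b := 0) (c := 2 ^ a + 1 - 1)
    (by omega) le_rfl (by omega) (by omega)
  constructor
  · constructor
    · intro h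
      by_contra hlt
      have hq : 2 ^ 3 ≤ 2 ^ a := Nat.pow_le_pow_right (by norm_num) (by omega)
      have := liftOne_mem_OS (a := a) (t := 2 ^ a - 2) (by omega) (by omega) (by omega)
      rw [← h, mem_GS] at this
      exact not_good_liftOne (by omega) this.2
    · intro h
      apply Finset.eq_of_subset_of_card_le hsub
      rcases (by omega : a = 1 ∨ a = 2) with rfl | rfl
      · omega
      · have h3 : liftOne (2 ^ 2) 3 ∈ GS (2 ^ 2 + 1) (2 ^ 2 + 1) :=
          mem_GS.2 ⟨liftOne_mem_OS (by norm_num) (by norm_num) (by norm_num), good_liftOne le_rfl⟩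
        have h4 : liftOne (2 ^ 2) 2 ∈ GS (2 ^ 2 + 1) (2 ^ 2 + 1) :=
          mem_GS.2 ⟨liftOne_mem_OS (by norm_num) (by norm_num) (by norm_num), good_liftOne_four⟩
        have h5 : liftOne (2 ^ 2) 3 ≠ liftOne (2 ^ 2) 2 := by
          intro h
          have := Finset.ext_iff.1 h 2
          simp [mem_liftOne] at this
        have h6 := three_le_card_of_mem
          (Finset.mem_erase.2 ⟨hookSet_ne_liftOne (by norm_num) rfl (by norm_num)
            (by norm_num), hrow⟩)
          (Finset.mem_erase.2 ⟨hookSet_ne_liftOne (by norm_num) rfl (by norm_num)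
            (by norm_num), hcol⟩)
          (Finset.mem_erase.2 ⟨h5, h3⟩) hne
          (hookSet_ne_liftOne (by norm_num) rfl (by norm_num) (by norm_num))
          (hookSet_ne_liftOne (by norm_num) rfl (by norm_num) (by norm_num))
        rw [Finset.card_erase_of_mem h4] at h6
        omega
  · constructor
    · intro h
      by_contra hlt
      have hq : 2 ^ 2 ≤ 2 ^ a := Nat.pow_le_pow_right (by norm_num) (by omega)
      have h3 : liftOne (2 ^ a) (2 ^ a - 1) ∈ GS (2 ^ a + 1) (2 ^ a + 1) :=
        mem_GS.2 ⟨liftOne_mem_OS (by omega) (by omega) (by omega), good_liftOne (by omega)⟩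
      have := three_le_card_of_mem hrow hcol h3 hne
        (hookSet_ne_liftOne (by omega) rfl (by omega) (by omega))
        (hookSet_ne_liftOne (by omega) rfl (by omega) (by omega))
      omega
    · rintro rfl
      omega

lemma GS_eq_OS_iff_and_card {m : ℕ} (hm : 2 ≤ m) :
    (GS m m = OS m m ↔ (m = 2 ∨ m = 3 ∨ m = 5)) ∧
      ((GS m m).card = 2 ↔ (m = 2 ∨ m = 3 ∨ m = 4)) := by
  obtain ⟨a, h1, h2⟩ := exists_pow_le (n := m) (by omega)
  obtain ⟨n, rfl⟩ : ∃ n, m = n + 2 ^ a := ⟨m - 2 ^ a, by omega⟩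
  have ha : 0 < a := by
    rcases Nat.eq_zero_or_pos a with rfl | h
    · omega
    · exact h
  have hcases : (a = 1 ∧ 2 ^ a = 2) ∨ (a = 2 ∧ 2 ^ a = 4) ∨ (2 < a ∧ 8 ≤ 2 ^ a) := by
    rcases (by omega : a = 1 ∨ a = 2 ∨ 2 < a) with rfl | rfl | h
    · exact Or.inl ⟨rfl, rfl⟩
    · exact Or.inr (Or.inl ⟨rfl, rfl⟩)
    · have : 2 ^ 3 ≤ 2 ^ a := Nat.pow_le_pow_right (by norm_num) h
      exact Or.inr (Or.inr ⟨h, by omega⟩)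
  rcases (by omega : n = 0 ∨ n = 1 ∨ 2 ≤ n) with rfl | rfl | hn
  · obtain ⟨h3, h4⟩ := card_GS_two_pow ha
    rw [zero_add, h3, h4]
    omega
  · obtain ⟨h3, h4⟩ := card_GS_two_pow_add_one ha
    rw [add_comm, h3, h4]
    omega
  · have hG := card_GS (M := n + 2 ^ a) hn (by omega) le_rfl
    have hO := card_OS (a := a) (n := n) (M := n + 2 ^ a) (by omega) le_rfl
    have h3 := two_le_card_GS (M := n + 2 ^ a) hn (by omega)
    have h4 := Finset.card_le_card (GS_subset_OS (n + 2 ^ a) n)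
    constructor
    · refine iff_of_false (fun h => ?_) (by omega)
      rw [h, hO] at hG
      have : (GS (n + 2 ^ a) n).card * (2 ^ a - 2) ≤ (OS (n + 2 ^ a) n).card * (2 ^ a - 2) :=
        Nat.mul_le_mul_right _ h4
      have : (OS (n + 2 ^ a) n).card * (2 ^ a - 2) < (OS (n + 2 ^ a) n).card * 2 ^ a :=
        Nat.mul_lt_mul_of_pos_left (by omega) (by omega)
      omega
    · refine iff_of_false (fun h => ?_) (by omega)
      have := Nat.mul_le_mul h3 (by omega : 2 ≤ 2 ^ a - 2)
      omega

theorem stmt13 (n r : ℕ) (a : ℕ → ℕ) (ε : ℕ) (hε : ε ≤ 1) (hr : 1 ≤ r)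
    (hdec : ∀ i j, 1 ≤ i → i < j → j ≤ r → a j < a i)
    (hpos : 0 < a r)
    (hn : n = (∑ i ∈ Finset.Icc 1 r, 2 ^ a i) + ε) (h2 : 2 ≤ n) :
    Gnum 0 n = Gnum 0 (2 ^ a r + ε) * ∏ j ∈ Finset.Icc 1 (r - 1), (2 ^ a j - 2) ∧
    (∀ m : ℕ, 2 ≤ m →
      (({lam : Multiset ℕ | OddP lam ∧ lam.sum = m ∧
          fkOp 0 (fkOp 0 lam) = fkOp 1 lam} =
        {lam : Multiset ℕ | OddP lam ∧ lam.sum = m}) ↔ (m = 2 ∨ m = 3 ∨ m = 5))) ∧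
    (∀ m : ℕ, 2 ≤ m →
      (({lam : Multiset ℕ | OddP lam ∧ lam.sum = m ∧
          fkOp 0 (fkOp 0 lam) = fkOp 1 lam} =
        {({m} : Multiset ℕ), Multiset.replicate m 1}) ↔ (m = 2 ∨ m = 3 ∨ m = 4))) := by
  refine ⟨?_, fun m hm => (goodOdd_eq_iff hm).trans (GS_eq_OS_iff_and_card hm).1,
    fun m hm => (goodOdd_eq_pair_iff hm).trans (GS_eq_OS_iff_and_card hm).2⟩
  obtain ⟨s, rfl⟩ : ∃ s, r = s + 1 := ⟨r - 1, by omega⟩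
  rw [hn]
  exact (Gnum_sum_two_pow hε s a hdec hpos).2.2

end OddSym
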